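/- arXiv:1404.4649 — 3 statements merged into one kernel-verified Lean document; each statement's English description precedes it below -/
import Mathlib

section
/- Let $k$ be an algebraically closed field of characteristic zero, let $d \geq 1$, and let $f \in k[t_0,\dots,t_d]$ be a homogeneous polynomial of degree $n$ with $1 \leq n \leq d+1$ such that the only common zero in $k^{d+1}$ of the partial derivatives $\partial f/\partial t_0, \dots, \partial f/\partial t_d$ is the origin (so that, by Euler's relation, $f$ defines a smooth hypersurface in $\mathbb{P}^d_k$). Then every maximal ideal $\mathfrak{m}$ of $k[t_0,\dots,t_d]$ with $f \in \mathfrak{m}$ and $\mathfrak{m} \neq (t_0,\dots,t_d)$ satisfies $\mathfrak{m} = (f, f_1, \dots, f_d)$ for some polynomials $f_1,\dots,f_d \in k[t_0,\dots,t_d]$; that is, every smooth closed point of $\mathrm{Spec}\, k[t_0,\dots,t_d]/(f)$ is a complete intersection. -/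
universe u v

open Polynomial in
theorem exists_dvd_pow_sub {k : Type*} [Field k] [IsAlgClosed k] [CharZero k] {N : ℕ}
    (hN : 0 < N) (u p : k[X]) (hp : p ≠ 0) (hup : ∀ α, p.IsRoot α → u.eval α ≠ 0) :
    ∃ s : k[X], p ∣ s ^ N - u := by
  induction hn : p.natDegree generalizing p with
  | zero =>
    have : IsUnit p := by
      rw [Polynomial.isUnit_iff_degree_eq_zero, Polynomial.degree_eq_natDegree hp, hn]; rfl
    exact ⟨0, this.dvd⟩
  | succ m ih =>
    obtain ⟨α, hα⟩ := IsAlgClosed.exists_root p (by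
      rw [Polynomial.degree_eq_natDegree hp, hn]; exact_mod_cast Nat.succ_ne_zero m)
    obtain ⟨q, rfl⟩ := Polynomial.dvd_iff_isRoot.2 hα
    have hq : q ≠ 0 := right_ne_zero_of_mul hp
    have hqd : q.natDegree = m := by
      rw [Polynomial.natDegree_mul (left_ne_zero_of_mul hp) hq, Polynomial.natDegree_X_sub_C] at hn
      omega
    obtain ⟨s, e, he⟩ := ih q hq (fun β hβ => hup β (hβ.dvd (Dvd.intro_left _ rfl))) hqd
    have hu : u.eval α ≠ 0 := hup α hα
    by_cases hqα : q.eval α = 0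
    · obtain ⟨c, hc⟩ := Polynomial.powAddExpansion s (q * C (-(e.eval α) /
        (N * (s.eval α) ^ (N - 1)))) N
      have hs : s.eval α ≠ 0 := by
        intro h0
        have := congrArg (Polynomial.eval α) he
        simp only [eval_sub, eval_pow, h0, zero_pow hN.ne', eval_mul, hqα, zero_mul, zero_sub,
          neg_eq_zero] at this
        exact hu this
      set w := -(e.eval α) / (N * (s.eval α) ^ (N - 1)) with hw
      refine ⟨s + q * C w, ?_⟩
      have : (s + q * C w) ^ N - u = q * (e + N * s ^ (N - 1) * C w + c * q * C w ^ 2) := by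
        rw [hc]; linear_combination he
      rw [this, mul_comm]
      refine mul_dvd_mul_left q (Polynomial.dvd_iff_isRoot.2 ?_)
      have hNk : (N : k) ≠ 0 := by exact_mod_cast hN.ne'
      simp only [IsRoot.def, eval_add, eval_mul, eval_natCast, eval_pow, eval_C, hqα, hw]
      field_simp
      ring
    · obtain ⟨r, hr⟩ := IsAlgClosed.exists_pow_nat_eq (u.eval α) hN
      set w := (r - s.eval α) / q.eval α with hw
      refine ⟨s + q * C w, ?_⟩
      have hcop : IsCoprime (X - C α) q := by
        rw [(Polynomial.irreducible_X_sub_C α).coprime_iff_not_dvd, dvd_iff_isRoot]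
        exact hqα
      refine hcop.mul_dvd (Polynomial.dvd_iff_isRoot.2 ?_) ?_
      · simp only [IsRoot.def, eval_add, eval_mul, eval_pow, eval_C, eval_sub, hw]
        rw [mul_div_cancel₀ _ hqα, add_sub_cancel, hr, sub_self]
      · have h1 : q ∣ (s + q * C w) ^ N - s ^ N :=
          (by simp : q ∣ (s + q * C w) - s).trans (sub_dvd_pow_sub_pow _ _ _)
        have := dvd_add h1 ⟨e, he⟩
        simpa using this

open Polynomial in
/-- A unit which is algebraic over an algebraically closed field of characteristic zero is a
square. -/
theorem IsUnit.exists_sq_of_isAlgebraic {k R : Type*} [Field k] [IsAlgClosed k] [CharZero k]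
    [CommRing R] [Algebra k R] {c : R} (hc : IsUnit c) (halg : IsAlgebraic k c) :
    ∃ r : R, c = r ^ 2 := by
  obtain ⟨p, hp, hpc⟩ := halg
  obtain ⟨q, hq, hX⟩ := Polynomial.exists_eq_pow_rootMultiplicity_mul_and_not_dvd p hp 0
  rw [C_0, sub_zero] at hq hX
  have hqc : aeval c q = 0 := by
    rw [hq, map_mul, map_pow, aeval_X] at hpc
    exact (hc.pow _).mul_right_eq_zero.1 hpc
  obtain ⟨s, t, hs⟩ := exists_dvd_pow_sub two_pos X q
    (fun h => hX (h ▸ dvd_zero _)) (by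
      intro α hα h0
      rw [eval_X] at h0
      subst h0
      exact hX (X_dvd_iff.2 (by rwa [coeff_zero_eq_eval_zero])))
  refine ⟨aeval c s, ?_⟩
  have := congrArg (aeval c) hs
  rw [map_mul, hqc, zero_mul, map_sub, map_pow, aeval_X] at this
  exact (sub_eq_zero.1 this).symm

open Polynomial in
theorem exists_coprime_pair_of_eval_one_ne_zero {k : Type*} [Field k] [IsAlgClosed k] [CharZero k]
    {n : ℕ} (hn : 0 < n) (p : k[X]) (hp : p.eval 1 ≠ 0) :
    ∃ Q Q' E E' : k[X], Q ≠ 0 ∧ Q' ≠ 0 ∧ IsCoprime Q Q' ∧ (X - 1) * Q ^ n = -1 + p * E ∧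
      Q * Q' = 1 + p * E' := by
  by_cases hu : IsUnit p
  · obtain ⟨v, hv⟩ := hu.exists_right_inv
    refine ⟨1, 1, X * v, 0, one_ne_zero, one_ne_zero, isCoprime_one_left, ?_, by simp⟩
    linear_combination (-X) * hv
  have hp0 : p ≠ 0 := by rintro rfl; simp at hp
  have hcop : IsCoprime (X - C 1) p := by
    rw [(Polynomial.irreducible_X_sub_C 1).coprime_iff_not_dvd, dvd_iff_isRoot]; exact hp
  obtain ⟨a, b, hab⟩ := hcop
  obtain ⟨Q, e, he⟩ := exists_dvd_pow_sub hn (-a) p hp0 (by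
    intro α hα h0
    have := congrArg (eval α) hab
    rw [eval_neg, neg_eq_zero] at h0
    rw [eval_add, eval_mul, eval_mul, hα.eq_zero, h0] at this
    simp at this)
  have h1 : (X - 1) * Q ^ n = -1 + p * ((X - 1) * e + b) := by
    rw [C_1] at hab
    linear_combination (X - 1) * he - hab
  obtain ⟨n, rfl⟩ : ∃ m, n = m + 1 := ⟨n - 1, by omega⟩
  set E := (X - 1) * e + b
  set a' := -(X - 1) * Q ^ n with ha'
  have h2 : a' * Q = 1 - p * E := by
    rw [ha']; linear_combination -h1
  have h3 : Q * (1 + Q * (1 - Q) * a' ^ 2) = 1 + p * ((1 - Q) * (p * E ^ 2 - 2 * E)) := by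
    linear_combination (1 - Q) * (a' * Q + (1 - p * E)) * h2
  refine ⟨Q, 1 + Q * (1 - Q) * a' ^ 2, E, _, ?_, ?_, ?_, h1, h3⟩
  · rintro rfl
    rw [zero_mul] at h3
    exact hu (IsUnit.of_mul_eq_one (-((1 - 0) * (p * E ^ 2 - 2 * E))) (by linear_combination h3))
  · intro h0
    rw [h0, mul_zero] at h3
    exact hu (IsUnit.of_mul_eq_one (-((1 - Q) * (p * E ^ 2 - 2 * E))) (by linear_combination h3))
  · exact ⟨-((1 - Q) * a' ^ 2), 1, by ring⟩

section Syzygies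

variable {A : Type u} [CommRing A]

/-- `K` is a first syzygy of `M`: the kernel of a surjection from a finite free module. -/
def IsSyzygy (A : Type u) [CommRing A] (M K : Type u) [AddCommGroup M] [Module A M]
    [AddCommGroup K] [Module A K] : Prop :=
  ∃ (F : Type u) (_ : AddCommGroup F) (_ : Module A F) (_ : Module.Free A F)
    (_ : Module.Finite A F) (i : K →ₗ[A] F) (π : F →ₗ[A] M),
    Function.Injective i ∧ Function.Surjective π ∧ Function.Exact i π

/-- `K` is a second syzygy of `M`. -/
def IsSecondSyzygy (A : Type u) [CommRing A] (M K : Type u) [AddCommGroup M] [Module A M]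
    [AddCommGroup K] [Module A K] : Prop :=
  ∃ (N : Type u) (_ : AddCommGroup N) (_ : Module A N), IsSyzygy A M N ∧ IsSyzygy A N K

/-- Stable isomorphism of modules. -/
def StablyIso (A : Type u) [CommRing A] (K K' : Type u) [AddCommGroup K] [Module A K]
    [AddCommGroup K'] [Module A K'] : Prop :=
  ∃ (F F' : Type u) (_ : AddCommGroup F) (_ : Module A F) (_ : Module.Free A F)
    (_ : Module.Finite A F) (_ : AddCommGroup F') (_ : Module A F') (_ : Module.Free A F')
    (_ : Module.Finite A F'), Nonempty ((K × F) ≃ₗ[A] (K' × F'))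

variable {M M' M'' K K' K'' : Type u} [AddCommGroup M] [Module A M]
  [AddCommGroup M'] [Module A M'] [AddCommGroup M''] [Module A M'']
  [AddCommGroup K] [Module A K] [AddCommGroup K'] [Module A K'] [AddCommGroup K''] [Module A K'']

theorem StablyIso.symm (h : StablyIso A K K') : StablyIso A K' K := by
  obtain ⟨F, F', _, _, _, _, _, _, _, _, ⟨e⟩⟩ := h
  exact ⟨F', F, _, _, ‹_›, ‹_›, _, _, ‹_›, ‹_›, ⟨e.symm⟩⟩

theorem StablyIso.of_equiv (e : K ≃ₗ[A] K') : StablyIso A K K' :=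
  ⟨PUnit, PUnit, _, _, inferInstance, inferInstance, _, _, inferInstance, inferInstance,
    ⟨e.prodCongr (LinearEquiv.refl A _)⟩⟩

theorem StablyIso.trans (h : StablyIso A K K') (h' : StablyIso A K' K'') : StablyIso A K K'' := by
  obtain ⟨F, F', _, _, _, _, _, _, _, _, ⟨e⟩⟩ := h
  obtain ⟨G, G', _, _, _, _, _, _, _, _, ⟨e'⟩⟩ := h'
  refine ⟨F × G, G' × F', _, _, inferInstance, inferInstance, _, _, inferInstance,
    inferInstance, ⟨?_⟩⟩
  exact (LinearEquiv.prodAssoc A K F G).symm ≪≫ₗ (e.prodCongr (LinearEquiv.refl A G)) ≪≫ₗ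
    LinearEquiv.prodAssoc A K' F' G ≪≫ₗ
    (LinearEquiv.refl A K').prodCongr (LinearEquiv.prodComm A F' G) ≪≫ₗ
    (LinearEquiv.prodAssoc A K' G F').symm ≪≫ₗ (e'.prodCongr (LinearEquiv.refl A F')) ≪≫ₗ
    LinearEquiv.prodAssoc A K'' G' F'

theorem IsSyzygy.of_equiv_left (h : IsSyzygy A M K) (e : M ≃ₗ[A] M') : IsSyzygy A M' K := by
  obtain ⟨F, _, _, _, _, i, π, hi, hπ, hex⟩ := h
  refine ⟨F, _, _, ‹_›, ‹_›, i, e.toLinearMap ∘ₗ π, hi, e.surjective.comp hπ, ?_⟩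
  intro x
  simp [← hex x]

theorem IsSyzygy.prod_free (h : IsSyzygy A M K) (G : Type u) [AddCommGroup G] [Module A G]
    [Module.Free A G] [Module.Finite A G] : IsSyzygy A (M × G) K := by
  obtain ⟨F, _, _, _, _, i, π, hi, hπ, hex⟩ := h
  refine ⟨F × G, _, _, inferInstance, inferInstance, LinearMap.inl A F G ∘ₗ i,
    π.prodMap LinearMap.id, ?_, ?_, ?_⟩
  · exact LinearMap.inl_injective.comp hi
  · exact hπ.prodMap Function.surjective_id
  · rintro ⟨x, y⟩
    have := hex x
    simp only [LinearMap.prodMap_apply, LinearMap.id_coe, id_eq, Prod.mk_eq_zero, Set.mem_range,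
      LinearMap.comp_apply, LinearMap.inl_apply, Prod.mk.injEq, exists_and_right] at this ⊢
    rw [this, eq_comm (a := y)]

theorem IsSyzygy.prod {N L : Type u} [AddCommGroup N] [Module A N] [AddCommGroup L] [Module A L]
    (h : IsSyzygy A M K) (h' : IsSyzygy A N L) : IsSyzygy A (M × N) (K × L) := by
  obtain ⟨F, _, _, _, _, i, π, hi, hπ, hex⟩ := h
  obtain ⟨F', _, _, _, _, i', π', hi', hπ', hex'⟩ := h'
  refine ⟨F × F', _, _, inferInstance, inferInstance, i.prodMap i', π.prodMap π',
    hi.prodMap hi', hπ.prodMap hπ', ?_⟩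
  rintro ⟨x, y⟩
  have h1 := hex x
  have h2 := hex' y
  simp only [Set.mem_range] at h1 h2
  simp [h1, h2]

/-- Schanuel's lemma. -/
theorem IsSyzygy.schanuel (h : IsSyzygy A M K) (h' : IsSyzygy A M K') : StablyIso A K K' := by
  obtain ⟨F, _, _, _, _, i, π, hi, hπ, hex⟩ := h
  obtain ⟨F', _, _, _, _, i', π', hi', hπ', hex'⟩ := h'
  obtain ⟨s, hs⟩ := Module.projective_lifting_property π π' hπ
  obtain ⟨s', hs'⟩ := Module.projective_lifting_property π' π hπ'
  have hs1 : ∀ x, π (s x) = π' x := fun x => LinearMap.congr_fun hs x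
  have hs1' : ∀ x, π' (s' x) = π x := fun x => LinearMap.congr_fun hs' x
  have hz : ∀ x, π (i x) = 0 := hex.apply_apply_eq_zero
  have hz' : ∀ x, π' (i' x) = 0 := hex'.apply_apply_eq_zero
  let P : Submodule A (F × F') :=
    LinearMap.ker (π ∘ₗ LinearMap.fst A F F' - π' ∘ₗ LinearMap.snd A F F')
  let a : (K × F') →ₗ[A] P := LinearMap.codRestrict P
    ((i.coprod s).prod (LinearMap.snd A K F')) (by
      rintro ⟨x, y⟩
      simp [P, hz, hs1])
  let b : (K' × F) →ₗ[A] P := LinearMap.codRestrict P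
    ((LinearMap.snd A K' F).prod (i'.coprod s')) (by
      rintro ⟨x, y⟩
      simp [P, hz', hs1'])
  have ha : Function.Bijective a := by
    constructor
    · rw [← LinearMap.ker_eq_bot, LinearMap.ker_eq_bot']
      rintro ⟨x, y⟩ hxy
      have := congrArg Subtype.val hxy
      have h0 : y = 0 := congrArg Prod.snd this
      have h1 : i x + s y = 0 := congrArg Prod.fst this
      subst h0
      rw [map_zero, add_zero] at h1
      rw [(map_eq_zero_iff _ hi).1 h1]; rfl
    · rintro ⟨⟨x, y⟩, hxy⟩
      have hxy' : π x = π' y := by simpa [P, sub_eq_zero] using hxy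
      obtain ⟨w, hw⟩ := (hex (x - s y)).1 (by rw [map_sub, hs1, hxy', sub_self])
      refine ⟨(w, y), ?_⟩
      apply Subtype.ext
      simp [a, hw]
  have hb : Function.Bijective b := by
    constructor
    · rw [← LinearMap.ker_eq_bot, LinearMap.ker_eq_bot']
      rintro ⟨x, y⟩ hxy
      have := congrArg Subtype.val hxy
      have h0 : y = 0 := congrArg Prod.fst this
      have h1 : i' x + s' y = 0 := congrArg Prod.snd this
      subst h0
      rw [map_zero, add_zero] at h1
      rw [(map_eq_zero_iff _ hi').1 h1]; rfl
    · rintro ⟨⟨x, y⟩, hxy⟩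
      have hxy' : π x = π' y := by simpa [P, sub_eq_zero] using hxy
      obtain ⟨w, hw⟩ := (hex' (y - s' x)).1 (by rw [map_sub, hs1', hxy', sub_self])
      refine ⟨(w, x), ?_⟩
      apply Subtype.ext
      simp [b, hw]
  exact ⟨F', F, _, _, ‹_›, ‹_›, _, _, ‹_›, ‹_›,
    ⟨(LinearEquiv.ofBijective a ha) ≪≫ₗ (LinearEquiv.ofBijective b hb).symm⟩⟩

theorem IsSyzygy.stablyIso (h : IsSyzygy A M K) (h' : IsSyzygy A M' K') (hM : StablyIso A M M') :
    StablyIso A K K' := by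
  obtain ⟨F, F', _, _, _, _, _, _, _, _, ⟨e⟩⟩ := hM
  exact ((h.prod_free F).of_equiv_left e).schanuel (h'.prod_free F')

theorem IsSecondSyzygy.stablyIso (h : IsSecondSyzygy A M K) (h' : IsSecondSyzygy A M K') :
    StablyIso A K K' := by
  obtain ⟨N, _, _, h1, h2⟩ := h
  obtain ⟨N', _, _, h1', h2'⟩ := h'
  exact h2.stablyIso h2' (h1.schanuel h1')

theorem IsSecondSyzygy.of_equiv_left (h : IsSecondSyzygy A M K) (e : M ≃ₗ[A] M') :
    IsSecondSyzygy A M' K := by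
  obtain ⟨N, _, _, h1, h2⟩ := h
  exact ⟨N, _, _, h1.of_equiv_left e, h2⟩

theorem IsSecondSyzygy.prod {N L : Type u} [AddCommGroup N] [Module A N] [AddCommGroup L]
    [Module A L] (h : IsSecondSyzygy A M K) (h' : IsSecondSyzygy A N L) :
    IsSecondSyzygy A (M × N) (K × L) := by
  obtain ⟨N, _, _, h1, h2⟩ := h
  obtain ⟨N', _, _, hN, hL⟩ := h'
  exact ⟨N × N', _, _, h1.prod hN, h2.prod hL⟩

/-- The horseshoe lemma for first syzygies. -/
theorem IsSyzygy.horseshoe {f : M' →ₗ[A] M} {g : M →ₗ[A] M''} (hf : Function.Injective f)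
    (hg : Function.Surjective g) (hfg : Function.Exact f g) (h' : IsSyzygy A M' K')
    (h'' : IsSyzygy A M'' K'') :
    ∃ (K : Type u) (_ : AddCommGroup K) (_ : Module A K) (i : K' →ₗ[A] K) (p : K →ₗ[A] K''),
      IsSyzygy A M K ∧ Function.Injective i ∧ Function.Surjective p ∧ Function.Exact i p := by
  obtain ⟨F', _, _, _, _, i', π', hi', hπ', hex'⟩ := h'
  obtain ⟨F'', _, _, _, _, i'', π'', hi'', hπ'', hex''⟩ := h''
  obtain ⟨σ, hσ⟩ := Module.projective_lifting_property g π'' hg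
  have hσ1 : ∀ x, g (σ x) = π'' x := fun x => LinearMap.congr_fun hσ x
  let π : (F' × F'') →ₗ[A] M := (f ∘ₗ π').coprod σ
  have hπ : ∀ a b, π (a, b) = f (π' a) + σ b := fun a b => rfl
  have hzero : ∀ x y, π (x, y) = 0 → π'' y = 0 := by
    intro x y h
    have := congrArg g h
    rwa [hπ, map_add, hfg.apply_apply_eq_zero, zero_add, hσ1, map_zero] at this
  let i : K' →ₗ[A] LinearMap.ker π := LinearMap.codRestrict _ (LinearMap.inl A F' F'' ∘ₗ i')
    (fun x => by simp [π, hex'.apply_apply_eq_zero])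
  let p' : LinearMap.ker π →ₗ[A] LinearMap.range i'' :=
    LinearMap.codRestrict _ (LinearMap.snd A F' F'' ∘ₗ (LinearMap.ker π).subtype) (by
      rintro ⟨⟨x, y⟩, h⟩
      exact (hex'' y).1 (hzero x y h))
  let e := LinearEquiv.ofInjective i'' hi''
  refine ⟨LinearMap.ker π, _, _, i, e.symm.toLinearMap ∘ₗ p', ?_, ?_, ?_, ?_⟩
  · refine ⟨F' × F'', _, _, inferInstance, inferInstance, (LinearMap.ker π).subtype, π,
      Subtype.val_injective, ?_, ?_⟩
    · intro m
      obtain ⟨b, hb⟩ := hπ'' (g m)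
      obtain ⟨m', hm'⟩ := (hfg (m - σ b)).1 (by rw [map_sub, hσ1, hb, sub_self])
      obtain ⟨a, ha⟩ := hπ' m'
      exact ⟨(a, b), by rw [hπ, ha, hm', sub_add_cancel]⟩
    · rw [LinearMap.exact_iff, Submodule.range_subtype]
  · intro x y h
    have := congrArg (fun t => (Subtype.val t).1) h
    exact hi' this
  · refine e.symm.surjective.comp ?_
    rintro ⟨_, ⟨w, rfl⟩⟩
    obtain ⟨m', hm'⟩ := (hfg (σ (i'' w))).1 (by rw [hσ1, hex''.apply_apply_eq_zero])
    obtain ⟨a, ha⟩ := hπ' m'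
    refine ⟨⟨(-a, i'' w), ?_⟩, rfl⟩
    rw [LinearMap.mem_ker, hπ, map_neg, map_neg, ha, hm', neg_add_cancel]
  · rintro ⟨⟨x, y⟩, hxy⟩
    rw [LinearMap.comp_apply, LinearEquiv.coe_coe, map_eq_zero_iff _ e.symm.injective]
    constructor
    · intro h
      have hy : y = 0 := congrArg Subtype.val h
      subst hy
      have hx : π' x = 0 := by
        have : π (x, 0) = 0 := hxy
        rw [hπ, map_zero, add_zero] at this
        exact (map_eq_zero_iff f hf).1 this
      obtain ⟨w, hw⟩ := (hex' x).1 hx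
      exact ⟨w, Subtype.ext (Prod.ext hw rfl)⟩
    · rintro ⟨w, hw⟩
      have := congrArg (fun t => (Subtype.val t).2) hw
      exact Subtype.ext this.symm

theorem nonempty_equiv_prod_of_exact [Module.Projective A K''] {i : K' →ₗ[A] K}
    {p : K →ₗ[A] K''} (hi : Function.Injective i) (hp : Function.Surjective p)
    (hip : Function.Exact i p) : Nonempty ((K' × K'') ≃ₗ[A] K) := by
  obtain ⟨s, hs⟩ := Module.projective_lifting_property p LinearMap.id hp
  have hs1 : ∀ x, p (s x) = x := fun x => LinearMap.congr_fun hs x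
  refine ⟨LinearEquiv.ofBijective (i.coprod s) ⟨?_, ?_⟩⟩
  · rw [← LinearMap.ker_eq_bot, LinearMap.ker_eq_bot']
    rintro ⟨x, y⟩ h
    rw [LinearMap.coprod_apply] at h
    have hy : y = 0 := by
      have := congrArg p h
      rwa [map_add, hip.apply_apply_eq_zero, zero_add, hs1, map_zero] at this
    subst hy
    rw [map_zero, add_zero] at h
    have hx : x = 0 := (map_eq_zero_iff i hi).1 h
    rw [hx]; rfl
  · intro m
    obtain ⟨w, hw⟩ := (hip (m - s (p m))).1 (by rw [map_sub, hs1, sub_self])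
    exact ⟨(w, p m), by rw [LinearMap.coprod_apply, hw, sub_add_cancel]⟩

theorem IsSyzygy.of_equiv_right (h : IsSyzygy A M K) (e : K' ≃ₗ[A] K) : IsSyzygy A M K' := by
  obtain ⟨F, _, _, _, _, i, π, hi, hπ, hex⟩ := h
  refine ⟨F, _, _, ‹_›, ‹_›, i ∘ₗ e.toLinearMap, π, hi.comp e.injective, hπ, ?_⟩
  intro x
  rw [hex x]
  exact ⟨fun ⟨y, hy⟩ => ⟨e.symm y, by simpa using hy⟩, fun ⟨y, hy⟩ => ⟨e y, hy⟩⟩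

/-- The horseshoe lemma for second syzygies, in the split case. -/
theorem IsSecondSyzygy.of_exact [Module.Projective A K''] {f : M' →ₗ[A] M} {g : M →ₗ[A] M''}
    (hf : Function.Injective f) (hg : Function.Surjective g) (hfg : Function.Exact f g)
    (h' : IsSecondSyzygy A M' K') (h'' : IsSecondSyzygy A M'' K'') :
    IsSecondSyzygy A M (K' × K'') := by
  obtain ⟨N', _, _, h1', h2'⟩ := h'
  obtain ⟨N'', _, _, h1'', h2''⟩ := h''
  obtain ⟨N, _, _, i, p, hN, hi, hp, hip⟩ := IsSyzygy.horseshoe hf hg hfg h1' h1''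
  obtain ⟨K, _, _, j, q, hK, hj, hq, hjq⟩ := IsSyzygy.horseshoe hi hp hip h2' h2''
  obtain ⟨e⟩ := nonempty_equiv_prod_of_exact hj hq hjq
  exact ⟨N, _, _, hN, hK.of_equiv_right e⟩

theorem StablyIso.projective (h : StablyIso A K K') [Module.Projective A K'] :
    Module.Projective A K := by
  obtain ⟨F, F', _, _, _, _, _, _, _, _, ⟨e⟩⟩ := h
  have : Module.Projective A (K × F) := Module.Projective.of_equiv e.symm
  exact Module.Projective.of_split (LinearMap.inl A K F) (LinearMap.fst A K F) (by ext; simp)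

theorem StablyIso.prod_left {L : Type u} [AddCommGroup L] [Module A L] (h : StablyIso A K K') :
    StablyIso A (L × K) (L × K') := by
  obtain ⟨F, F', _, _, _, _, _, _, _, _, ⟨e⟩⟩ := h
  exact ⟨F, F', _, _, ‹_›, ‹_›, _, _, ‹_›, ‹_›, ⟨LinearEquiv.prodAssoc A L K F ≪≫ₗ
    (LinearEquiv.refl A L).prodCongr e ≪≫ₗ (LinearEquiv.prodAssoc A L K' F').symm⟩⟩

end Syzygies

section UnimodularRows

variable {A : Type u} [CommRing A]

/-- Two vectors in the same orbit under linear automorphisms. -/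
def SameOrbit (A : Type*) [CommRing A] {V : Type*} [AddCommGroup V] [Module A V] (u v : V) : Prop :=
  ∃ g : V ≃ₗ[A] V, g u = v

variable {V : Type*} [AddCommGroup V] [Module A V]

theorem SameOrbit.trans {u v w : V} (h : SameOrbit A u v) (h' : SameOrbit A v w) :
    SameOrbit A u w := by
  obtain ⟨g, rfl⟩ := h
  obtain ⟨g', rfl⟩ := h'
  exact ⟨g ≪≫ₗ g', rfl⟩

theorem SameOrbit.symm {u v : V} (h : SameOrbit A u v) : SameOrbit A v u := by
  obtain ⟨g, rfl⟩ := h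
  exact ⟨g.symm, g.symm_apply_apply u⟩

theorem sameOrbit_add_smul (a : A) (v w : V) : SameOrbit A (a, v) (a, v + a • w) :=
  ⟨LinearEquiv.ofLinearMap
    ((LinearMap.fst A A V).prod (LinearMap.snd A A V + (LinearMap.fst A A V).smulRight w))
    ((LinearMap.fst A A V).prod (LinearMap.snd A A V - (LinearMap.fst A A V).smulRight w))
    (by ext <;> simp) (by ext <;> simp), by simp⟩

theorem sameOrbit_add_apply (a : A) (v : V) (φ : V →ₗ[A] A) :
    SameOrbit A (a, v) (a + φ v, v) :=
  ⟨LinearEquiv.ofLinearMap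
    ((LinearMap.fst A A V + φ ∘ₗ LinearMap.snd A A V).prod (LinearMap.snd A A V))
    ((LinearMap.fst A A V - φ ∘ₗ LinearMap.snd A A V).prod (LinearMap.snd A A V))
    (by ext <;> simp) (by ext <;> simp), by simp⟩

theorem sameOrbit_of_apply_eq_one (a : A) (v : V) (φ : V →ₗ[A] A) (hφ : φ v = 1) :
    SameOrbit A (a, v) (1, 0) := by
  have h1 := sameOrbit_add_apply a v ((1 - a) • φ)
  have h2 := sameOrbit_add_smul (1 : A) v (-v)
  simp only [LinearMap.smul_apply, hφ, smul_eq_mul, mul_one, add_sub_cancel] at h1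
  simp only [smul_neg, one_smul, add_neg_cancel] at h2
  exact h1.trans h2

/-- A unimodular row of length three whose first entry is a square is completable. -/
theorem sameOrbit_sq (a B C X Y Z : A) (h : a * X + B * Y + C * Z = 1) :
    SameOrbit A ((a ^ 2, ![B, C]) : A × (Fin 2 → A)) (1, 0) := by
  let M : Matrix (Fin 3) (Fin 3) A :=
    !![a ^ 2, C - 2 * a * Y, -B - 2 * a * Z; B, X + Z * Y, Z ^ 2; C, -Y ^ 2, X - Z * Y]
  have hM : M.det = 1 := by
    simp only [M, Matrix.det_fin_three, Matrix.of_apply, Matrix.cons_val', Matrix.cons_val_zero,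
      Matrix.cons_val_one, Matrix.cons_val]
    linear_combination (a * X + B * Y + C * Z + 1) * h
  have hu : IsUnit M.det := by rw [hM]; exact isUnit_one
  let e : (Fin 3 → A) ≃ₗ[A] (Fin 3 → A) := M.toLinearEquiv (Pi.basisFun A (Fin 3)) hu
  let L : (A × (Fin 2 → A)) ≃ₗ[A] (Fin 3 → A) := Fin.consLinearEquiv A (fun _ : Fin 3 => A)
  refine SameOrbit.symm ⟨L ≪≫ₗ e ≪≫ₗ L.symm, ?_⟩
  rw [LinearEquiv.trans_apply, LinearEquiv.trans_apply, LinearEquiv.symm_apply_eq]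
  have : ∀ x, e x = M.mulVec x := fun x => by
    simp [e, Matrix.toLinearEquiv, Matrix.toLin_eq_toLin']
  rw [this]
  have h0 : L (1, 0) = ![1, 0, 0] := by
    ext i; fin_cases i <;> rfl
  have h1 : L (a ^ 2, ![B, C]) = ![a ^ 2, B, C] := by
    ext i; fin_cases i <;> rfl
  rw [h0, h1]
  ext i
  fin_cases i <;> simp [M, Matrix.mulVec, dotProduct, Fin.sum_univ_three]

theorem exists_pow_mul_aeval_sub_mem {k K : Type*} [CommRing k] [CommRing K]
    [Algebra k A] [Algebra A K] [Algebra k K] [IsScalarTower k A K] {σ : Type*}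
      (J : Ideal A) (a : A)
    (x : σ → K) (s r : σ → A) (hr : ∀ i, algebraMap A K (r i) = algebraMap A K a * x i)
    (hs : ∀ i, r i - a * s i ∈ J) (p : MvPolynomial σ k) :
    ∃ (D : ℕ) (c : A), algebraMap A K c = algebraMap A K a ^ D * MvPolynomial.aeval x p ∧
      c - a ^ D * MvPolynomial.aeval s p ∈ J := by
  induction p using MvPolynomial.induction_on with
  | C t => exact ⟨0, algebraMap k A t, by simp [← IsScalarTower.algebraMap_apply], by simp⟩
  | add p q hp hq =>
    obtain ⟨D, c, h1, h2⟩ := hp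
    obtain ⟨D', c', h1', h2'⟩ := hq
    refine ⟨D + D', a ^ D' * c + a ^ D * c', ?_, ?_⟩
    · simp only [map_add, map_mul, map_pow, h1, h1']; ring
    · have := J.add_mem (J.mul_mem_left (a ^ D') h2) (J.mul_mem_left (a ^ D) h2')
      convert this using 1
      rw [map_add]; ring
  | mul_X p i hp =>
    obtain ⟨D, c, h1, h2⟩ := hp
    refine ⟨D + 1, c * r i, ?_, ?_⟩
    · simp only [map_mul, h1, hr, MvPolynomial.aeval_X]; ring
    · have := J.add_mem (J.mul_mem_left (r i) h2)
        (J.mul_mem_left (a ^ D * MvPolynomial.aeval s p) (hs i))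
      convert this using 1
      rw [map_mul, MvPolynomial.aeval_X]; ring

theorem exists_pow_mul_aeval_mem {k : Type*} [CommRing k] [Algebra k A] {σ : Type*}
    (J : Ideal A) (a : A)
    (x : σ → FractionRing A) (s r : σ → A)
    (hr : ∀ i, algebraMap A (FractionRing A) (r i) = algebraMap A (FractionRing A) a * x i)
    (hs : ∀ i, r i - a * s i ∈ J) (p : MvPolynomial σ k) (hp : MvPolynomial.aeval x p = 0) :
    ∃ D : ℕ, a ^ D * MvPolynomial.aeval s p ∈ J := by
  obtain ⟨D, c, h1, h2⟩ := exists_pow_mul_aeval_sub_mem (k := k) J a x s r hr hs p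
  rw [hp, mul_zero, map_eq_zero_iff _ (IsFractionRing.injective A (FractionRing A))] at h1
  subst h1
  exact ⟨D, by simpa using J.neg_mem h2⟩

theorem exists_eval_ne_zero_of_not_algebraicIndependent {k K σ : Type*} [Field k] [Infinite k]
    [CommRing K] [Algebra k K] {x : σ → K}
    (hx : ¬ AlgebraicIndependent k x) : ∃ (p : MvPolynomial σ k) (ν : σ → k),
      MvPolynomial.aeval x p = 0 ∧ MvPolynomial.eval ν p ≠ 0 := by
  rw [algebraicIndependent_iff] at hx
  push Not at hx
  obtain ⟨p, hp, hp0⟩ := hx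
  refine ⟨p, ?_⟩
  by_contra! h
  exact hp0 (MvPolynomial.funext fun ν => by simpa using h ν hp)

variable [IsDomain A] {k : Type*} [Field k] [IsAlgClosed k] [CharZero k] [Algebra k A]

/-- Completability of unimodular rows of length at least three over an algebra of transcendence
degree at most two. -/
theorem sameOrbit_of_unimodular (hA : ∀ x : Fin 3 → FractionRing A, ¬ AlgebraicIndependent k x)
    {N : ℕ} (hN : 2 ≤ N) (a : A) (v : Fin N → A) (φ : A × (Fin N → A) →ₗ[A] A)
    (hφ : φ (a, v) = 1) : SameOrbit A (a, v) (1, 0) := by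
  have hφ' : a * φ (1, 0) + ∑ i, v i * φ (0, Pi.single i 1) = 1 := by
    have : (a, v) = a • ((1, 0) : A × (Fin N → A)) +
        ∑ i, v i • ((0, Pi.single i 1) : A × (Fin N → A)) := by
      ext i
      · simp [Prod.fst_sum]
      · simp [Finset.sum_apply, Pi.single_apply, Prod.snd_sum]
    have h1 := congrArg φ this
    simp only [map_add, map_smul, map_sum, smul_eq_mul] at h1
    rw [← h1, hφ]
  by_cases ha : a = 0
  · subst ha
    exact sameOrbit_of_apply_eq_one 0 v (φ ∘ₗ LinearMap.inr A A _) hφ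
  have ha' : algebraMap A (FractionRing A) a ≠ 0 := by
    rwa [Ne, map_eq_zero_iff _ (IsFractionRing.injective A (FractionRing A))]
  have hdiv : ∀ b : A, algebraMap A (FractionRing A) b = algebraMap A (FractionRing A) a *
      (algebraMap A (FractionRing A) b / algebraMap A (FractionRing A) a) :=
    fun b => (mul_div_cancel₀ _ ha').symm
  rcases hN.eq_or_lt with rfl | hN
  · obtain ⟨p, ν, hp, hν⟩ := exists_eval_ne_zero_of_not_algebraicIndependent (k := k)
      (hA ![algebraMap A _ (v 0) / algebraMap A _ a, algebraMap A _ (v 1) / algebraMap A _ a,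
        algebraMap A _ a])
    set w : Fin 2 → A := fun i => algebraMap k A (-ν i.castSucc) with hw
    refine (sameOrbit_add_smul a v w).trans ?_
    set v' := v + a • w with hv'
    let J : Ideal A := Ideal.span {v' 0, v' 1}
    obtain ⟨D, hD⟩ := exists_pow_mul_aeval_mem (k := k) J a _
      ![algebraMap k A (ν 0), algebraMap k A (ν 1), a] ![v 0, v 1, a ^ 2] (by
        intro i
        fin_cases i
        · exact hdiv _
        · exact hdiv _
        · simp [pow_two]) (by
        intro i
        fin_cases i
        · have : v 0 - a * algebraMap k A (ν 0) = v' 0 := by simp [hv', hw]; ring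
          change v 0 - a * algebraMap k A (ν 0) ∈ J
          rw [this]
          exact Ideal.subset_span (by simp)
        · have : v 1 - a * algebraMap k A (ν 1) = v' 1 := by simp [hv', hw]; ring
          change v 1 - a * algebraMap k A (ν 1) ∈ J
          rw [this]
          exact Ideal.subset_span (by simp)
        · simp [pow_two]) p hp
    have hone : ∃ α β γ : A, a * α + v' 0 * β + v' 1 * γ = 1 := by
      refine ⟨φ (1, 0) - w 0 * φ (0, Pi.single 0 1) - w 1 * φ (0, Pi.single 1 1),
        φ (0, Pi.single 0 1), φ (0, Pi.single 1 1), ?_⟩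
      rw [Fin.sum_univ_two] at hφ'
      simp only [hv', Pi.add_apply, Pi.smul_apply, smul_eq_mul]
      linear_combination hφ'
    obtain ⟨α, β, γ, hαβγ⟩ := hone
    have hunit : IsUnit (Ideal.Quotient.mk J a) := by
      refine IsUnit.of_mul_eq_one (Ideal.Quotient.mk J α) ?_
      rw [← map_mul, ← map_one (Ideal.Quotient.mk J), Ideal.Quotient.eq]
      refine Ideal.mem_span_pair.2 ⟨-β, -γ, ?_⟩
      linear_combination -hαβγ
    have halg : IsAlgebraic k (Ideal.Quotient.mk J a) := by
      refine ⟨MvPolynomial.aeval ![Polynomial.C (ν 0), Polynomial.C (ν 1), Polynomial.X] p, ?_, ?_⟩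
      · intro h0
        have := congrArg (Polynomial.aeval (ν 2)) h0
        rw [← AlgHom.comp_apply, MvPolynomial.comp_aeval, map_zero] at this
        refine hν ?_
        rw [← this, ← MvPolynomial.coe_aeval_eq_eval]
        change MvPolynomial.aeval ν p = _
        congr 2
        ext i
        fin_cases i <;> simp
      · have h1 : (Ideal.Quotient.mk J a) ^ D * Ideal.Quotient.mk J (MvPolynomial.aeval
            ![algebraMap k A (ν 0), algebraMap k A (ν 1), a] p) = 0 := by
          rw [← map_pow, ← map_mul]
          exact Ideal.Quotient.eq_zero_iff_mem.2 hD
        have h2 := (hunit.pow D).mul_right_eq_zero.1 h1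
        rw [← h2, ← AlgHom.comp_apply, MvPolynomial.comp_aeval]
        change _ = Ideal.Quotient.mkₐ k J _
        rw [← AlgHom.comp_apply, MvPolynomial.comp_aeval]
        congr 2
        ext i
        fin_cases i <;> simp
    obtain ⟨r', hr'⟩ := hunit.exists_sq_of_isAlgebraic halg
    obtain ⟨r, rfl⟩ := Ideal.Quotient.mk_surjective r'
    rw [← map_pow, Ideal.Quotient.eq, Ideal.mem_span_pair] at hr'
    obtain ⟨c, c', hc⟩ := hr'
    have h1 := sameOrbit_add_apply a v' (-(c • LinearMap.proj 0 + c' • LinearMap.proj 1))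
    have h2 : a + (-(c • LinearMap.proj 0 + c' • LinearMap.proj 1) : (Fin 2 → A) →ₗ[A] A) v' =
        r ^ 2 := by
      simp; linear_combination -hc
    rw [h2] at h1
    have h3 : v' = ![v' 0, v' 1] := by ext i; fin_cases i <;> rfl
    refine h1.trans ?_
    rw [h3]
    exact sameOrbit_sq r _ _ (r * α) (β + c * α) (γ + c' * α) (by
      linear_combination hαβγ + α * hc)
  · let j : Fin 3 → Fin N := Fin.castLE hN
    have hj : Function.Injective j := Fin.castLE_injective hN
    obtain ⟨p, ν, hp, hν⟩ := exists_eval_ne_zero_of_not_algebraicIndependent (k := k)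
      (hA (fun i => algebraMap A _ (v (j i)) / algebraMap A _ a))
    set w : Fin N → A := fun i => if h : i.1 < 3 then algebraMap k A (-ν ⟨i.1, h⟩) else 0 with hw
    have hwj : ∀ i, w (j i) = algebraMap k A (-ν i) := by
      intro i
      simp [hw, j]
    refine (sameOrbit_add_smul a v w).trans ?_
    set v' := v + a • w with hv'
    let J : Ideal A := Ideal.span (Set.range v')
    have hvJ : ∀ i, v' i ∈ J := fun i => Ideal.subset_span ⟨i, rfl⟩
    obtain ⟨D, hD⟩ := exists_pow_mul_aeval_mem (k := k) J a _
      (fun i => algebraMap k A (ν i)) (fun i => v (j i)) (fun i => hdiv _) (by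
        intro i
        have : v (j i) - a * algebraMap k A (ν i) = v' (j i) := by simp [hv', hwj]; ring
        rw [this]
        exact hvJ _) p hp
    have haD : a ^ D ∈ J := by
      have h1 : MvPolynomial.aeval (fun i => algebraMap k A (ν i)) p =
          algebraMap k A (MvPolynomial.eval ν p) := by
        have h2 := MvPolynomial.aeval_algebraMap_apply (B := A) ν p
        rwa [← MvPolynomial.coe_aeval_eq_eval]
      rw [h1] at hD
      have h2 := J.mul_mem_right (algebraMap k A (MvPolynomial.eval ν p)⁻¹) hD
      rwa [mul_assoc, ← map_mul, mul_inv_cancel₀ hν, map_one, mul_one] at h2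
    have hJ : J = ⊤ := by
      rw [← Ideal.radical_eq_top, Ideal.eq_top_iff_one, ← hφ']
      have har : a ∈ J.radical := ⟨D, haD⟩
      refine Ideal.add_mem _ (Ideal.mul_mem_right _ _ har) (Ideal.sum_mem _ fun i _ =>
        Ideal.mul_mem_right _ _ ?_)
      have : v i = v' i - a * w i := by simp [hv']
      rw [this]
      exact Ideal.sub_mem _ (Ideal.le_radical (hvJ i)) (Ideal.mul_mem_right _ _ har)
    have h1 : (1 : A) ∈ Ideal.span (Set.range v') := by
      change (1 : A) ∈ J
      rw [hJ]; trivial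
    obtain ⟨c, hc⟩ := Ideal.mem_span_range_iff_exists_fun.1 h1
    refine sameOrbit_of_apply_eq_one a v' (∑ i, c i • LinearMap.proj i) ?_
    simpa [LinearMap.sum_apply] using hc

theorem nonempty_equiv_of_prod_equiv {P : Type*} [AddCommGroup P] [Module A P]
    (hA : ∀ x : Fin 3 → FractionRing A, ¬ AlgebraicIndependent k x)
    {N : ℕ} (hN : 2 ≤ N) (e : (A × P) ≃ₗ[A] (A × (Fin N → A))) :
    Nonempty (P ≃ₗ[A] (Fin N → A)) := by
  obtain ⟨g, hg⟩ := sameOrbit_of_unimodular (k := k) hA hN (e (1, 0)).1 (e (1, 0)).2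
    (LinearMap.fst A A P ∘ₗ e.symm.toLinearMap) (by simp)
  let e' := e ≪≫ₗ g
  have he' : e' (1, 0) = (1, 0) := hg
  have hc : ∀ c : A, e' (c, 0) = (c, 0) := fun c => by
    have := congrArg (c • ·) he'
    simpa [← map_smul] using this
  refine ⟨LinearEquiv.ofBijective
    (LinearMap.snd A A _ ∘ₗ e'.toLinearMap ∘ₗ LinearMap.inr A A P) ⟨?_, ?_⟩⟩
  · rw [← LinearMap.ker_eq_bot, LinearMap.ker_eq_bot']
    intro x hx
    have h1 : e' (0, x) = e' ((e' (0, x)).1, 0) := by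
      rw [hc]
      exact Prod.ext rfl hx
    exact congrArg Prod.snd (e'.injective h1)
  · intro y
    refine ⟨(e'.symm (0, y)).2, ?_⟩
    have h1 : ((0, (e'.symm (0, y)).2) : A × P) = e'.symm (0, y) - ((e'.symm (0, y)).1, 0) := by
      ext <;> simp
    simp only [LinearMap.comp_apply, LinearMap.inr_apply, LinearEquiv.coe_coe, h1, map_sub, hc]
    simp

end UnimodularRows

section SecondSyzygies

variable {A : Type u} [CommRing A] {K K' K'' : Type u} [AddCommGroup K] [Module A K]
  [AddCommGroup K'] [Module A K'] [AddCommGroup K''] [Module A K'']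

theorem IsSecondSyzygy.of_equiv_right {M : Type u} [AddCommGroup M] [Module A M]
    (h : IsSecondSyzygy A M K) (e : K' ≃ₗ[A] K) : IsSecondSyzygy A M K' := by
  obtain ⟨N, _, _, h1, h2⟩ := h
  exact ⟨N, _, _, h1, h2.of_equiv_right e⟩

theorem IsSecondSyzygy.quotient_of_colon [Module.Projective A K''] {I I' I'' : Ideal A} (t : A)
    (h1 : ∀ a, t * a ∈ I ↔ a ∈ I') (h2 : I'' = I ⊔ Ideal.span {t})
    (h' : IsSecondSyzygy A (A ⧸ I') K') (h'' : IsSecondSyzygy A (A ⧸ I'') K'') :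
    IsSecondSyzygy A (A ⧸ I) (K' × K'') := by
  have hle : I ≤ I'' := h2 ▸ le_sup_left
  have hcomap : I' ≤ Submodule.comap (LinearMap.mulLeft A t) I := fun a ha => (h1 a).2 ha
  obtain ⟨f, hf⟩ : ∃ f : (A ⧸ I') →ₗ[A] (A ⧸ I),
      ∀ a, f (Submodule.Quotient.mk a) = Submodule.Quotient.mk (t * a) :=
    ⟨Submodule.mapQ I' I (LinearMap.mulLeft A t) hcomap, fun a => rfl⟩
  obtain ⟨g, hg⟩ : ∃ g : (A ⧸ I) →ₗ[A] (A ⧸ I''),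
      ∀ a, g (Submodule.Quotient.mk a) = Submodule.Quotient.mk a :=
    ⟨Submodule.factor hle, fun a => rfl⟩
  refine IsSecondSyzygy.of_exact (f := f) (g := g) ?_ ?_ ?_ h' h''
  · rw [← LinearMap.ker_eq_bot, LinearMap.ker_eq_bot']
    intro a
    obtain ⟨a, rfl⟩ := Submodule.Quotient.mk_surjective _ a
    intro ha
    rw [hf, Submodule.Quotient.mk_eq_zero] at ha
    exact (Submodule.Quotient.mk_eq_zero _).2 ((h1 a).1 ha)
  · intro a
    obtain ⟨a, rfl⟩ := Submodule.Quotient.mk_surjective _ a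
    exact ⟨_, hg a⟩
  · intro a
    obtain ⟨a, rfl⟩ := Submodule.Quotient.mk_surjective _ a
    rw [hg, Submodule.Quotient.mk_eq_zero, h2]
    constructor
    · intro ha
      obtain ⟨b, hb, c, hc, rfl⟩ := Submodule.mem_sup.1 ha
      obtain ⟨c, rfl⟩ := Ideal.mem_span_singleton'.1 hc
      refine ⟨Submodule.Quotient.mk c, ?_⟩
      rw [hf, Submodule.Quotient.eq]
      have : t * c - (b + c * t) = -b := by ring
      rw [this]
      exact I.neg_mem hb
    · rintro ⟨c, hc⟩
      obtain ⟨c, rfl⟩ := Submodule.Quotient.mk_surjective _ c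
      rw [hf, Submodule.Quotient.eq] at hc
      have := Submodule.sub_mem _ (Ideal.mem_sup_right (S := I) (Ideal.mul_mem_right c _
        (Ideal.mem_span_singleton_self t))) (Ideal.mem_sup_left (T := Ideal.span {t}) hc)
      simpa using this

theorem IsSyzygy.quotient (I : Ideal A) : IsSyzygy A (A ⧸ I) I :=
  ⟨A, _, _, inferInstance, inferInstance, I.subtype, I.mkQ, Subtype.val_injective,
    Submodule.mkQ_surjective I, by rw [LinearMap.exact_iff, Submodule.range_subtype, I.ker_mkQ]⟩

theorem IsSecondSyzygy.quotient_ker {F : Type u} [AddCommGroup F] [Module A F] [Module.Free A F]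
    [Module.Finite A F] (θ : F →ₗ[A] A) :
    IsSecondSyzygy A (A ⧸ (LinearMap.range θ : Ideal A)) (LinearMap.ker θ) := by
  refine ⟨_, _, _, IsSyzygy.quotient _, F, _, _, ‹_›, ‹_›, (LinearMap.ker θ).subtype,
    θ.rangeRestrict, Subtype.val_injective, θ.surjective_rangeRestrict, ?_⟩
  rw [LinearMap.exact_iff, Submodule.range_subtype, LinearMap.ker_rangeRestrict]

theorem IsSecondSyzygy.of_regular_pair [IsDomain A] {u v : A} (hu : u ≠ 0)
    (huv : ∀ b, b * v ∈ Ideal.span {u} → b ∈ Ideal.span {u}) :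
    IsSecondSyzygy A (A ⧸ Ideal.span {u, v}) A := by
  let θ : (A × A) →ₗ[A] A := (LinearMap.mulRight A u).coprod (LinearMap.mulRight A v)
  have hθ : (LinearMap.range θ : Ideal A) = Ideal.span {u, v} := by
    ext a
    rw [Ideal.mem_span_pair]
    constructor
    · rintro ⟨⟨b, c⟩, h⟩; exact ⟨b, c, h⟩
    · rintro ⟨b, c, h⟩; exact ⟨(b, c), h⟩
  rw [← hθ]
  let i : A →ₗ[A] LinearMap.ker θ := LinearMap.codRestrict _
    ((LinearMap.mulRight A (-v)).prod (LinearMap.mulRight A u)) (by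
      intro c
      simp [θ]; ring)
  refine (IsSecondSyzygy.quotient_ker θ).of_equiv_right (LinearEquiv.ofBijective i ⟨?_, ?_⟩)
  · intro c c' h
    have := congrArg (fun t => (Subtype.val t).2) h
    exact mul_right_cancel₀ hu this
  · rintro ⟨⟨b, c⟩, h⟩
    have h' : b * u + c * v = 0 := h
    obtain ⟨w, rfl⟩ := Ideal.mem_span_singleton'.1
      (huv c (Ideal.mem_span_singleton'.2 ⟨-b, by linear_combination -h'⟩))
    refine ⟨w, Subtype.ext (Prod.ext ?_ rfl)⟩
    refine mul_right_cancel₀ hu (?_ : w * (-v) * u = b * u)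
    linear_combination -h'

theorem IsSecondSyzygy.chain [Module.Projective A K] (I : ℕ → Ideal A) (n : ℕ) (t : A) (J : Ideal A)
    (h1 : ∀ i < n, ∀ a, t * a ∈ I (i + 1) ↔ a ∈ I i)
    (h2 : ∀ i < n, J = I (i + 1) ⊔ Ideal.span {t}) (h0 : IsSecondSyzygy A (A ⧸ I 0) K')
    (hJ : IsSecondSyzygy A (A ⧸ J) K) : IsSecondSyzygy A (A ⧸ I n) (K' × (Fin n → K)) := by
  suffices ∀ i ≤ n, IsSecondSyzygy A (A ⧸ I i) (K' × (Fin i → K)) from this n le_rfl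
  intro i
  induction i with
  | zero =>
    intro _
    exact h0.of_equiv_right LinearEquiv.prodUnique
  | succ i ih =>
    intro hi
    refine (IsSecondSyzygy.quotient_of_colon t (h1 i hi) (h2 i hi)
      (ih (by omega)) hJ).of_equiv_right ?_
    exact (LinearEquiv.refl A K').prodCongr ((Fin.consLinearEquiv A (fun _ => K)).symm ≪≫ₗ
      LinearEquiv.prodComm A _ _) ≪≫ₗ (LinearEquiv.prodAssoc A K' (Fin i → K) K).symm

/-- The Chinese remainder theorem as a linear equivalence. -/
noncomputable def quotientInfLinearEquiv (I J : Ideal A) (h : IsCoprime I J) :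
    (A ⧸ (I ⊓ J)) ≃ₗ[A] (A ⧸ I) × (A ⧸ J) where
  __ := Ideal.quotientInfEquivQuotientProd I J h
  map_smul' a x := by
    obtain ⟨x, rfl⟩ := Ideal.Quotient.mk_surjective x
    rfl

end SecondSyzygies

section LineOnSurface

open Polynomial

variable {A : Type u} [CommRing A] [IsDomain A] {k : Type*} [Field k] [Algebra k A]

/-- The linear form with coefficients `(q, y, z)`. -/
def rowForm (q y z : A) : A × (Fin 2 → A) →ₗ[A] A :=
  (LinearMap.mulRight A q).coprod
    (LinearMap.mulRight A y ∘ₗ LinearMap.proj 0 + LinearMap.mulRight A z ∘ₗ LinearMap.proj 1)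

omit [IsDomain A] in
theorem rowForm_apply (q y z : A) (v : A × (Fin 2 → A)) :
    rowForm q y z v = v.1 * q + (v.2 0 * y + v.2 1 * z) := rfl

omit [IsDomain A] in
theorem range_rowForm (q y z : A) :
    (LinearMap.range (rowForm q y z) : Ideal A) = Ideal.span {q, y, z} := by
  ext a
  rw [Submodule.mem_span_triple, LinearMap.mem_range]
  constructor
  · rintro ⟨v, rfl⟩
    exact ⟨v.1, v.2 0, v.2 1, by rw [rowForm_apply]; simp [add_assoc]⟩
  · rintro ⟨b, c, d, rfl⟩
    exact ⟨(b, ![c, d]), by rw [rowForm_apply]; simp [add_assoc]⟩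

variable {ι : k[X] →ₐ[k] A} {ev : A →ₐ[k] k[X]} {y z B : A} {n : ℕ}

omit [IsDomain A] in
theorem span_triple_eq_comap (hev : ∀ q, ev (ι q) = q)
    (hker : ∀ a, ev a = 0 ↔ a ∈ Ideal.span {y, z}) (q : k[X]) :
    Ideal.span {ι q, y, z} = (Ideal.span {q}).comap ev := by
  have hle : Ideal.span {y, z} ≤ Ideal.span {ι q, y, z} := Ideal.span_mono (by simp)
  apply le_antisymm
  · rw [Ideal.span_le]
    have h1 : ev y = 0 := (hker y).2 (Ideal.subset_span (by simp))
    have h2 : ev z = 0 := (hker z).2 (Ideal.subset_span (by simp))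
    rintro a (rfl | rfl | rfl)
    · simp [hev]
    · simp [h1]
    · simp [h2]
  · intro a ha
    obtain ⟨c, hc⟩ := Ideal.mem_span_singleton'.1 (Ideal.mem_comap.1 ha)
    have h1 : a - ι (c * q) ∈ Ideal.span {y, z} := by
      rw [← hker, map_sub, hev, hc, sub_self]
    have h2 := Ideal.add_mem _ (hle h1) (Ideal.mul_mem_left _ (ι c)
      (Ideal.subset_span (by simp : ι q ∈ ({ι q, y, z} : Set A))))
    simpa using h2

omit [IsDomain A] in
theorem isSecondSyzygy_ker_rowForm (hev : ∀ q, ev (ι q) = q)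
    (hker : ∀ a, ev a = 0 ↔ a ∈ Ideal.span {y, z}) (q : k[X]) :
    IsSecondSyzygy A (A ⧸ (Ideal.span {q}).comap ev) (LinearMap.ker (rowForm (ι q) y z)) := by
  rw [← span_triple_eq_comap hev hker, ← range_rowForm]
  exact IsSecondSyzygy.quotient_ker _

theorem isSecondSyzygy_of_eq_const_add (hev : ∀ q, ev (ι q) = q)
    (hker : ∀ a, ev a = 0 ↔ a ∈ Ideal.span {y, z}) (hn : 1 ≤ n) (hzn : z ^ n = y * B)
    (hB : ev B ≠ 0) (hz : z ≠ 0) {q E : k[X]} {c : k} (hc : c ≠ 0) (hq0 : q ≠ 0)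
    (hq : q = C c + ev B * E) : IsSecondSyzygy A (A ⧸ (Ideal.span {q}).comap ev) A := by
  have hyz : ∀ a ∈ Ideal.span {y, z}, ∃ b d, b * y + d * z = a := fun a ha =>
    Ideal.mem_span_pair.1 ha
  have hzn' : z ∣ y * B := hzn ▸ dvd_pow_self z (by omega)
  have hevz : ev z = 0 := (hker z).2 (Ideal.subset_span (by simp))
  set h := ι (C c) + ι E * B with hh
  have hevh : ev h = q := by rw [hh, map_add, map_mul, hev, hev, hq]; ring
  have hcu : ι (C c⁻¹) * ι (C c) = 1 := by
    rw [← map_mul, ← C_mul, inv_mul_cancel₀ hc, C_1, map_one]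
  have hy : y ∈ Ideal.span {z, h} := by
    obtain ⟨w, hw⟩ := hzn'
    refine Ideal.mem_span_pair.2 ⟨-(ι (C c⁻¹) * ι E * w), ι (C c⁻¹) * y, ?_⟩
    linear_combination y * hcu + ι (C c⁻¹) * ι E * hw
  have hz' : z ∈ Ideal.span {z, h} := Ideal.subset_span (by simp)
  have hle : Ideal.span {y, z} ≤ Ideal.span {z, h} := by
    rw [Ideal.span_le]; rintro a (rfl | rfl) <;> assumption
  have hspan : (Ideal.span {q}).comap ev = Ideal.span {z, h} := by
    apply le_antisymm
    · rw [← span_triple_eq_comap hev hker, Ideal.span_le]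
      rintro a (rfl | rfl | rfl)
      · have h1 : ι q - h ∈ Ideal.span {y, z} := by rw [← hker, map_sub, hev, hevh, sub_self]
        have := Ideal.add_mem _ (hle h1)
          (Ideal.subset_span (by simp : h ∈ ({z, h} : Set A)))
        simpa using this
      · exact hy
      · exact hz'
    · rw [Ideal.span_le]
      rintro a (rfl | rfl)
      · simp [hevz]
      · simp [hevh]
  rw [hspan]
  refine IsSecondSyzygy.of_regular_pair hz fun g hg => ?_
  rw [Ideal.mem_span_singleton] at hg ⊢
  obtain ⟨w, hw⟩ := hg
  -- modulo `(z, B)` the element `h` is a unit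
  have h1 : g = z * (ι (C c⁻¹) * w) + B * (-(ι (C c⁻¹) * ι E * g)) := by
    linear_combination (-g) * hcu + ι (C c⁻¹) * hw
  set g' := -(ι (C c⁻¹) * ι E * g)
  have h2 : ev g' = 0 := by
    have h3 : q * ev B * ev g' = 0 := by
      have h4 := congrArg ev h1
      have h5 := congrArg ev hw
      simp only [map_mul, map_add, hevz, hevh, zero_mul, zero_add] at h4 h5
      rw [mul_assoc, ← h4, mul_comm, h5]
    simpa [hq0, hB] using h3
  obtain ⟨b, d, hbd⟩ := hyz g' ((hker g').1 h2)
  rw [h1, ← hbd]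
  refine dvd_add (dvd_mul_right _ _) ?_
  have : B * (b * y + d * z) = b * (y * B) + z * (B * d) := by ring
  rw [this]
  exact dvd_add (Dvd.dvd.mul_left hzn' b) (dvd_mul_right _ _)

omit [IsDomain A] in
theorem mem_span_pow_of_mul_mem (hev : ∀ q, ev (ι q) = q)
    (hker : ∀ a, ev a = 0 ↔ a ∈ Ideal.span {y, z})
    (hyz : ∀ e, z * e ∈ Ideal.span {y} → e ∈ Ideal.span {y, z ^ (n - 1)})
    {q : k[X]} (hq : q ≠ 0) : ∀ j ≤ n, ∀ a, ι q * a ∈ Ideal.span {y, z ^ j} →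
      a ∈ Ideal.span {y, z ^ j} := by
  intro j
  induction j with
  | zero =>
    intro _ a _
    have : (1 : A) ∈ Ideal.span {y, z ^ 0} := Ideal.subset_span (by simp)
    rw [(Ideal.eq_top_iff_one _).2 this]; trivial
  | succ j ih =>
    intro hj a ha
    have hle : Ideal.span {y, z ^ (j + 1)} ≤ Ideal.span {y, z} := by
      rw [Ideal.span_le]
      rintro x (rfl | rfl)
      · exact Ideal.subset_span (by simp)
      · exact Ideal.pow_mem_of_mem _ (Ideal.subset_span (by simp)) _ (by omega)
    have h1 : ev a = 0 := by
      have := (hker _).2 (hle ha)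
      rw [map_mul, hev] at this
      exact (mul_eq_zero.1 this).resolve_left hq
    obtain ⟨b, d, rfl⟩ := Ideal.mem_span_pair.1 ((hker a).1 h1)
    obtain ⟨b', d', h2⟩ := Ideal.mem_span_pair.1 ha
    have h3 := hyz (ι q * d - z ^ j * d') (Ideal.mem_span_singleton'.2
      ⟨b' - ι q * b, by linear_combination h2⟩)
    have hle' : Ideal.span {y, z ^ (n - 1)} ≤ Ideal.span {y, z ^ j} := by
      rw [Ideal.span_le]
      rintro x (rfl | rfl)
      · exact Ideal.subset_span (by simp)
      · exact Ideal.mem_of_dvd _ (pow_dvd_pow z (by omega : j ≤ n - 1))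
          (Ideal.subset_span (by simp))
    have h4 : ι q * d ∈ Ideal.span {y, z ^ j} := by
      have := Ideal.add_mem _ (hle' h3) (Ideal.mul_mem_right d' _
        (Ideal.subset_span (by simp : z ^ j ∈ ({y, z ^ j} : Set A))))
      simpa using this
    obtain ⟨b'', d'', h5⟩ := Ideal.mem_span_pair.1 (ih (by omega) d h4)
    exact Ideal.mem_span_pair.2 ⟨b + b'' * z, d'', by rw [← h5]; ring⟩

theorem projective_ker_rowForm (hev : ∀ q, ev (ι q) = q)
    (hker : ∀ a, ev a = 0 ↔ a ∈ Ideal.span {y, z}) (hn : 1 ≤ n) (hzn : z ^ n = y * B)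
    (hB : ev B ≠ 0) (hz : z ≠ 0) {Q Q' E : k[X]} (hQ : Q ≠ 0) (hQ' : Q' ≠ 0)
    (hcop : IsCoprime Q Q') (hE : Q * Q' = 1 + ev B * E) :
    Module.Projective A (LinearMap.ker (rowForm (ι Q) y z)) := by
  have h1 : IsSecondSyzygy A (A ⧸ (Ideal.span {Q * Q'}).comap ev) A :=
    isSecondSyzygy_of_eq_const_add hev hker hn hzn hB hz one_ne_zero (mul_ne_zero hQ hQ')
      (by rw [hE, C_1])
  have h3 : IsCoprime ((Ideal.span {Q}).comap ev) ((Ideal.span {Q'}).comap ev) := by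
    obtain ⟨a, b, hab⟩ := hcop
    rw [Ideal.isCoprime_iff_exists]
    refine ⟨1 - ι (b * Q'), ?_, ι (b * Q'), ?_, by ring⟩
    · rw [Ideal.mem_comap, map_sub, hev, map_one, ← hab, Ideal.mem_span_singleton]
      exact ⟨a, by ring⟩
    · rw [Ideal.mem_comap, hev, Ideal.mem_span_singleton]
      exact dvd_mul_left _ _
  have h2 : (Ideal.span {Q * Q'}).comap ev =
      (Ideal.span {Q}).comap ev ⊓ (Ideal.span {Q'}).comap ev := by
    rw [← Ideal.comap_inf, ← Ideal.span_singleton_mul_span_singleton,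
      Ideal.mul_eq_inf_of_isCoprime ((Ideal.isCoprime_span_singleton_iff _ _).2 hcop)]
  rw [h2] at h1
  have h4 := ((isSecondSyzygy_ker_rowForm hev hker Q).prod
    (isSecondSyzygy_ker_rowForm hev hker Q')).stablyIso
      (h1.of_equiv_left (quotientInfLinearEquiv _ _ h3))
  have := h4.projective
  exact Module.Projective.of_split (LinearMap.inl A _ _)
    (LinearMap.fst A _ (LinearMap.ker (rowForm (ι Q') y z)))
    (by ext <;> simp)

omit [IsDomain A] in
theorem mul_mem_span_triple_pow_succ_iff (hev : ∀ q, ev (ι q) = q)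
    (hker : ∀ a, ev a = 0 ↔ a ∈ Ideal.span {y, z})
    (hyz : ∀ e, z * e ∈ Ideal.span {y} → e ∈ Ideal.span {y, z ^ (n - 1)})
    {q : k[X]} (hq : q ≠ 0) {i : ℕ} (hi : i < n) (a : A) :
    z * a ∈ Ideal.span {ι q, y, z ^ (i + 1)} ↔ a ∈ Ideal.span {ι q, y, z ^ i} := by
  rw [Ideal.span, Submodule.mem_span_triple, Ideal.span, Submodule.mem_span_triple]
  simp only [smul_eq_mul]
  constructor
  · rintro ⟨c, d, b, h⟩
    have h1 : ev c = 0 := by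
      have h2 : ι q * c ∈ Ideal.span {y, z} :=
        Ideal.mem_span_pair.2 ⟨-d, a - b * z ^ i, by linear_combination -h⟩
      have := (hker _).2 h2
      rw [map_mul, hev] at this
      exact (mul_eq_zero.1 this).resolve_left hq
    obtain ⟨c₁, c₂, rfl⟩ := Ideal.mem_span_pair.1 ((hker c).1 h1)
    have h2 := hyz (a - b * z ^ i - ι q * c₂) (Ideal.mem_span_singleton'.2
      ⟨d + c₁ * ι q, by linear_combination h⟩)
    obtain ⟨d₁, d₂, h3⟩ := Ideal.mem_span_pair.1 h2
    have h4 : z ^ (n - 1) = z ^ (n - 1 - i) * z ^ i := by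
      rw [← pow_add]; congr 1; omega
    exact ⟨c₂, d₁, b + d₂ * z ^ (n - 1 - i), by linear_combination h3 - d₂ * h4⟩
  · rintro ⟨c, d, b, rfl⟩
    exact ⟨z * c, z * d, b, by ring⟩

theorem stablyIso_pow_ker_rowForm (hev : ∀ q, ev (ι q) = q)
    (hker : ∀ a, ev a = 0 ↔ a ∈ Ideal.span {y, z}) (hzn : z ^ n = y * B) (hy : y ≠ 0)
    (hyz : ∀ e, z * e ∈ Ideal.span {y} → e ∈ Ideal.span {y, z ^ (n - 1)}) {Q : k[X]} (hQ : Q ≠ 0)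
    [Module.Projective A (LinearMap.ker (rowForm (ι Q) y z))] :
    StablyIso A (PUnit.{u + 1} × (Fin n → LinearMap.ker (rowForm (ι Q) y z))) A := by
  have h1 : IsSecondSyzygy A (A ⧸ Ideal.span {y, ι Q}) A :=
    IsSecondSyzygy.of_regular_pair hy fun b hb => by
      have hyn : Ideal.span {y, z ^ n} = Ideal.span {y} := by
        apply le_antisymm
        · rw [Ideal.span_le]
          rintro x (rfl | rfl)
          · exact Ideal.mem_span_singleton_self _
          · rw [hzn]; exact Ideal.mul_mem_right _ _ (Ideal.mem_span_singleton_self _)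
        · exact Ideal.span_mono (by simp)
      have := mem_span_pow_of_mul_mem hev hker hyz hQ n le_rfl b
      rw [hyn, mul_comm] at this
      exact this hb
  have h2 : Ideal.span {y, ι Q} = Ideal.span {ι Q, y, z ^ n} := by
    apply le_antisymm
    · exact Ideal.span_mono (by intro x; simp; tauto)
    · rw [Ideal.span_le]
      rintro x (rfl | rfl | rfl)
      · exact Ideal.subset_span (by simp)
      · exact Ideal.subset_span (by simp)
      · rw [hzn]; exact Ideal.mul_mem_right _ _ (Ideal.subset_span (by simp))
  rw [h2] at h1
  refine IsSecondSyzygy.stablyIso (IsSecondSyzygy.chain (fun i => Ideal.span {ι Q, y, z ^ i}) n z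
    ((Ideal.span {Q}).comap ev) ?_ ?_ ?_ (isSecondSyzygy_ker_rowForm hev hker Q)) h1
  · exact fun i hi a => mul_mem_span_triple_pow_succ_iff hev hker hyz hQ hi a
  · intro i hi
    rw [← span_triple_eq_comap hev hker, ← Ideal.span_union]
    apply le_antisymm
    · exact Ideal.span_mono (by intro x; simp; tauto)
    · rw [Ideal.span_le]
      have : z ∈ Ideal.span {ι Q, y, z} := Ideal.subset_span (by simp)
      rintro x ((rfl | rfl | rfl) | rfl)
      · exact Ideal.subset_span (by simp)
      · exact Ideal.subset_span (by simp)
      · exact Ideal.pow_mem_of_mem _ this _ (by omega)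
      · exact this
  · have htop : Ideal.span {ι Q, y, z ^ 0} = ⊤ :=
      (Ideal.eq_top_iff_one _).2 (Ideal.subset_span (by simp))
    have : Subsingleton (A ⧸ Ideal.span {ι Q, y, z ^ 0}) :=
      Ideal.Quotient.subsingleton_iff.2 htop
    have h0 : IsSyzygy A PUnit.{u + 1} PUnit.{u + 1} :=
      ⟨PUnit, _, _, inferInstance, inferInstance, 0, 0, fun _ _ _ => rfl, fun _ => ⟨0, rfl⟩,
        fun x => ⟨fun _ => ⟨0, rfl⟩, fun _ => rfl⟩⟩
    refine IsSecondSyzygy.of_equiv_left ⟨_, _, _, h0, h0⟩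
      (LinearEquiv.ofBijective 0 ⟨fun _ _ _ => rfl, fun x => ⟨0, Subsingleton.elim _ _⟩⟩)

theorem stablyIso_ker_rowForm_prod_pow (hev : ∀ q, ev (ι q) = q)
    (hker : ∀ a, ev a = 0 ↔ a ∈ Ideal.span {y, z}) (hn : 1 ≤ n) (hzn : z ^ n = y * B)
    (hB : ev B ≠ 0) (hz : z ≠ 0) {P Q E : k[X]} (hP : P ≠ 0) (hQ : Q ≠ 0)
    (hE : P * Q ^ n = -1 + ev B * E)
    [Module.Projective A (LinearMap.ker (rowForm (ι Q) y z))] :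
    StablyIso A (LinearMap.ker (rowForm (ι P) y z) ×
      (Fin n → LinearMap.ker (rowForm (ι Q) y z))) A := by
  have h1 : IsSecondSyzygy A (A ⧸ (Ideal.span {P * Q ^ n}).comap ev) A :=
    isSecondSyzygy_of_eq_const_add hev hker hn hzn hB hz (neg_ne_zero.2 one_ne_zero)
      (mul_ne_zero hP (pow_ne_zero _ hQ)) (by rw [hE, C_neg, C_1])
  refine IsSecondSyzygy.stablyIso (IsSecondSyzygy.chain
    (fun i => (Ideal.span {P * Q ^ i}).comap ev) n (ι Q)
    ((Ideal.span {Q}).comap ev) ?_ ?_ ?_ (isSecondSyzygy_ker_rowForm hev hker Q)) h1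
  · intro i hi a
    simp only [Ideal.mem_comap, Ideal.mem_span_singleton, map_mul, hev]
    rw [pow_succ', ← mul_assoc, mul_comm P Q, mul_assoc, mul_dvd_mul_iff_left hQ]
  · intro i hi
    apply le_antisymm
    · intro a ha
      obtain ⟨c, hc⟩ := Ideal.mem_span_singleton'.1 (Ideal.mem_comap.1 ha)
      have h2 : a - ι c * ι Q ∈ (Ideal.span {P * Q ^ (i + 1)}).comap ev := by
        rw [Ideal.mem_comap, map_sub, map_mul, hev, hev, hc, sub_self]
        exact Ideal.zero_mem _
      have h3 := Submodule.add_mem_sup h2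
        (Ideal.mul_mem_left _ (ι c) (Ideal.mem_span_singleton_self (ι Q)))
      rwa [sub_add_cancel] at h3
    · refine sup_le (Ideal.comap_mono ?_) ?_
      · rw [Ideal.span_singleton_le_span_singleton]
        exact Dvd.intro_left (P * Q ^ i) (by ring)
      · rw [Ideal.span_singleton_le_iff_mem, Ideal.mem_comap, hev]
        exact Ideal.mem_span_singleton_self Q
  · have h0 : ∀ R, R = P → IsSecondSyzygy A (A ⧸ (Ideal.span {R}).comap ev)
        (LinearMap.ker (rowForm (ι P) y z)) := by
      rintro _ rfl
      exact isSecondSyzygy_ker_rowForm hev hker _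
    exact h0 _ (by simp)

theorem stablyIso_ker_rowForm_prod_self [IsAlgClosed k] [CharZero k] (hev : ∀ q, ev (ι q) = q)
    (hker : ∀ a, ev a = 0 ↔ a ∈ Ideal.span {y, z}) (hn : 1 ≤ n) (hzn : z ^ n = y * B)
    (hB : (ev B).eval 1 ≠ 0) (hy : y ≠ 0) (hz : z ≠ 0)
    (hyz : ∀ e, z * e ∈ Ideal.span {y} → e ∈ Ideal.span {y, z ^ (n - 1)}) :
    StablyIso A (LinearMap.ker (rowForm (ι (X - 1)) y z) × A) A := by
  have hB0 : ev B ≠ 0 := by intro h; simp [h] at hB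
  obtain ⟨Q, Q', E, E', hQ, hQ', hcop, hE, hE'⟩ := exists_coprime_pair_of_eval_one_ne_zero hn _ hB
  have hX : (X - 1 : k[X]) ≠ 0 := X_sub_C_ne_zero 1
  have hproj := projective_ker_rowForm hev hker hn hzn hB0 hz hQ hQ' hcop hE'
  have h1 := stablyIso_pow_ker_rowForm hev hker hzn hy hyz hQ
  have h2 := stablyIso_ker_rowForm_prod_pow hev hker hn hzn hB0 hz hX hQ hE
  have e : ((LinearMap.ker (rowForm (ι (X - 1)) y z)) × (PUnit.{u + 1} ×
      (Fin n → LinearMap.ker (rowForm (ι Q) y z)))) ≃ₗ[A] (LinearMap.ker (rowForm (ι (X - 1)) y z) ×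
      (Fin n → LinearMap.ker (rowForm (ι Q) y z))) :=
    (LinearEquiv.refl A _).prodCongr LinearEquiv.uniqueProd
  exact (h1.prod_left (L := LinearMap.ker (rowForm (ι (X - 1)) y z))).symm.trans
    ((StablyIso.of_equiv e).trans h2)

end LineOnSurface

section LineOnSurface

open Polynomial

variable {A : Type u} [CommRing A] [IsDomain A] {k : Type*} [Field k] [IsAlgClosed k] [CharZero k]
  [Algebra k A]

theorem nonempty_equiv_of_prod_pow_equiv {P : Type*} [AddCommGroup P] [Module A P]
    (hA : ∀ x : Fin 3 → FractionRing A, ¬ AlgebraicIndependent k x) (m : ℕ)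
    (e : (P × (Fin m → A)) ≃ₗ[A] (Fin (m + 2) → A)) : Nonempty (P ≃ₗ[A] (Fin 2 → A)) := by
  induction m with
  | zero => exact ⟨LinearEquiv.prodUnique.symm ≪≫ₗ e⟩
  | succ m ih =>
    have e₁ : (A × (P × (Fin m → A))) ≃ₗ[A] (P × (Fin (m + 1) → A)) :=
      (LinearEquiv.prodAssoc A A P _).symm ≪≫ₗ
        (LinearEquiv.prodComm A A P).prodCongr (LinearEquiv.refl A _) ≪≫ₗ
        LinearEquiv.prodAssoc A P A _ ≪≫ₗ
        (LinearEquiv.refl A P).prodCongr (Fin.consLinearEquiv A fun _ => A)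
    obtain ⟨e'⟩ := nonempty_equiv_of_prod_equiv hA (by omega : 2 ≤ m + 2)
      (e₁ ≪≫ₗ e ≪≫ₗ (Fin.consLinearEquiv A fun _ : Fin (m + 2 + 1) => A).symm)
    exact ih e'

theorem StablyIso.nonempty_equiv {P : Type u} [AddCommGroup P] [Module A P]
    (hA : ∀ x : Fin 3 → FractionRing A, ¬ AlgebraicIndependent k x)
    (h : StablyIso A (P × A) A) (hP : Module.rank A P = 2) : Nonempty (P ≃ₗ[A] (Fin 2 → A)) := by
  obtain ⟨F, F', _, _, _, _, _, _, _, _, ⟨e⟩⟩ := h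
  have eF := (Module.finBasis A F).equivFun
  have eF' := (Module.finBasis A F').equivFun
  set r := Module.finrank A F
  set s := Module.finrank A F'
  have e₁ : (P × (Fin (r + 1) → A)) ≃ₗ[A] (Fin (s + 1) → A) :=
    (LinearEquiv.refl A P).prodCongr (Fin.consLinearEquiv A fun _ => A).symm ≪≫ₗ
      (LinearEquiv.prodAssoc A P A _).symm ≪≫ₗ
      (LinearEquiv.refl A _).prodCongr eF.symm ≪≫ₗ e ≪≫ₗ
      (LinearEquiv.refl A A).prodCongr eF' ≪≫ₗ (Fin.consLinearEquiv A fun _ : Fin (s + 1) => A)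
  have h1 := (LinearMap.fst A P (Fin (r + 1) → A)).rank_range_add_rank_ker
  rw [LinearMap.range_eq_top.2 LinearMap.fst_surjective, rank_top, LinearMap.ker_fst,
    (LinearEquiv.ofInjective _ LinearMap.inr_injective).symm.rank_eq, e₁.rank_eq, hP,
    rank_fin_fun, rank_fin_fun] at h1
  have h2 : s = r + 2 := by
    have : 2 + (r + 1) = s + 1 := by exact_mod_cast h1
    omega
  rw [h2] at e₁
  exact nonempty_equiv_of_prod_pow_equiv hA (r + 1) e₁

omit [IsAlgClosed k] [CharZero k] in
theorem rank_ker_rowForm {q y z : A} (hz : z ≠ 0) :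
    Module.rank A (LinearMap.ker (rowForm q y z)) = 2 := by
  have h1 := (rowForm q y z).rank_range_add_rank_ker
  have h2 : Module.rank A (LinearMap.range (rowForm q y z)) = 1 := by
    apply le_antisymm
    · exact (LinearMap.range (rowForm q y z)).rank_le.trans (by simp)
    · have hz' : z ∈ LinearMap.range (rowForm q y z) := ⟨(0, ![0, 1]), by simp [rowForm_apply]⟩
      have := LinearMap.rank_le_of_injective
        (LinearMap.toSpanSingleton A (LinearMap.range (rowForm q y z)) ⟨z, hz'⟩) (by
          rw [← LinearMap.ker_eq_bot, LinearMap.ker_eq_bot']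
          intro a ha
          have := congrArg Subtype.val ha
          simpa [hz] using this)
      simpa using this
  rw [h2, rank_prod', rank_fin_fun, Module.rank_self] at h1
  exact Cardinal.eq_of_add_eq_add_left h1 Cardinal.one_lt_aleph0

variable {ι : k[X] →ₐ[k] A} {ev : A →ₐ[k] k[X]} {y z B : A} {n : ℕ}

theorem exists_span_triple_eq_span_pair_of_basis
    (hA : ∀ x : Fin 3 → FractionRing A, ¬ AlgebraicIndependent k x) (hev : ∀ q, ev (ι q) = q)
    (hker : ∀ a, ev a = 0 ↔ a ∈ Ideal.span {y, z}) {v w : A × (Fin 2 → A)}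
    (hv : rowForm (ι (X - 1)) y z v = 0)
    (hvw : ∀ u, rowForm (ι (X - 1)) y z u = 0 → ∃ a b : A, u = a • v + b • w)
    (hv1 : (ev (v.2 0)).eval 1 ≠ 0) :
    ∃ g h, Ideal.span {ι (X - 1), y, z} = Ideal.span {g, h} := by
  set x := ι (X - 1) with hx
  have hminor : ∀ M : Ideal A, M.IsPrime → v.1 ∈ M → v.2 0 ∈ M → v.2 1 ∈ M →
      x ∈ M ∧ y ∈ M ∧ z ∈ M := by
    intro M hM h0 h1 h2
    obtain ⟨a, b, hab⟩ := hvw (y, ![-x, 0]) (by simp [rowForm_apply]; ring)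
    obtain ⟨a', b', hab'⟩ := hvw (z, ![0, -x]) (by simp [rowForm_apply]; ring)
    obtain ⟨a'', b'', hab''⟩ := hvw (0, ![z, -y]) (by simp [rowForm_apply]; ring)
    have e0 := congrArg Prod.fst hab
    have e1 := congrFun (congrArg Prod.snd hab) 0
    have e2 := congrFun (congrArg Prod.snd hab) 1
    have f0 := congrArg Prod.fst hab'
    have f1 := congrFun (congrArg Prod.snd hab') 0
    have f2 := congrFun (congrArg Prod.snd hab') 1
    have g0 := congrArg Prod.fst hab''
    have g1 := congrFun (congrArg Prod.snd hab'') 0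
    have g2 := congrFun (congrArg Prod.snd hab'') 1
    simp only [Prod.fst_add, Prod.smul_fst, Prod.snd_add, Prod.smul_snd, smul_eq_mul, Pi.add_apply,
      Pi.smul_apply, Matrix.cons_val_zero, Matrix.cons_val_one] at e0 e1 e2 f0 f1 f2 g0 g1 g2
    rw [← Ideal.Quotient.eq_zero_iff_mem] at h0 h1 h2
    simp only [← Ideal.Quotient.eq_zero_iff_mem (I := M)]
    apply_fun Ideal.Quotient.mk M at e0 e1 e2 f0 f1 f2 g0 g1 g2
    simp only [map_add, map_mul, map_neg, map_zero, h0, h1, h2, mul_zero, zero_add]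
      at e0 e1 e2 f0 f1 f2 g0 g1 g2
    have : IsDomain (A ⧸ M) := Ideal.Quotient.isDomain M
    generalize Ideal.Quotient.mk M x = x' at *
    generalize Ideal.Quotient.mk M y = y' at *
    generalize Ideal.Quotient.mk M z = z' at *
    generalize Ideal.Quotient.mk M w.1 = w0 at *
    generalize Ideal.Quotient.mk M (w.2 0) = w1 at *
    generalize Ideal.Quotient.mk M (w.2 1) = w2 at *
    generalize Ideal.Quotient.mk M b = b at *
    generalize Ideal.Quotient.mk M b' = b' at *
    generalize Ideal.Quotient.mk M b'' = b'' at *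
    refine ⟨pow_eq_zero_iff two_ne_zero |>.1 ?_, pow_eq_zero_iff two_ne_zero |>.1 ?_,
      pow_eq_zero_iff two_ne_zero |>.1 ?_⟩
    · linear_combination (-x') * e1 + b * w1 * f2 - b * w2 * f1
    · linear_combination y' * e0 - b * w0 * g2 + b * w2 * g0
    · linear_combination z' * f0 + b' * w0 * g1 - b' * w1 * g0
  have htop : Ideal.span {v.1, v.2 0, v.2 1} = ⊤ := by
    by_contra hne
    obtain ⟨M, hM, hle⟩ := Ideal.exists_le_maximal _ hne
    rw [Ideal.span_le] at hle
    obtain ⟨h0, h1, h2⟩ := hminor M hM.isPrime (hle (by simp)) (hle (by simp)) (hle (by simp))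
    have h3 : Ideal.span {x, y, z} ≤ M := by
      rw [Ideal.span_le]; rintro a (rfl | rfl | rfl) <;> assumption
    have h4 : v.2 0 - ι (C ((ev (v.2 0)).eval 1)) ∈ M := by
      apply h3
      rw [hx, span_triple_eq_comap hev hker, Ideal.mem_comap, map_sub, hev,
        Ideal.mem_span_singleton, ← C_1, dvd_iff_isRoot]
      simp
    have h5 : ι (C ((ev (v.2 0)).eval 1)) ∈ M := by
      have := M.sub_mem (hle (by simp) : v.2 0 ∈ M) h4
      rwa [sub_sub_cancel] at this
    exact hM.ne_top (Ideal.eq_top_of_isUnit_mem _ h5 (((isUnit_iff_ne_zero.2 hv1).map C).map ι))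
  have h1 : (1 : A) ∈ Ideal.span {v.1, v.2 0, v.2 1} := htop ▸ Submodule.mem_top
  obtain ⟨p, q, r, hpqr⟩ := Submodule.mem_span_triple.1 h1
  obtain ⟨g, hg⟩ := sameOrbit_of_unimodular (k := k) hA le_rfl v.1 v.2 (rowForm p q r) (by
    rw [rowForm_apply, ← hpqr]; simp only [smul_eq_mul]; ring)
  have hg' : g.symm (1, 0) = v := by rw [← hg]; simp
  refine ⟨rowForm x y z (g.symm (0, ![1, 0])), rowForm x y z (g.symm (0, ![0, 1])), ?_⟩
  rw [← range_rowForm]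
  ext a
  rw [LinearMap.mem_range, Ideal.mem_span_pair]
  constructor
  · rintro ⟨u, rfl⟩
    refine ⟨(g u).2 0, (g u).2 1, ?_⟩
    have h2 : g u = (g u).1 • ((1, 0) : A × (Fin 2 → A)) + ((g u).2 0 • (0, ![1, 0]) +
        (g u).2 1 • (0, ![0, 1])) := by
      ext i
      · simp
      · fin_cases i <;> simp
    have h3 := congrArg (fun t => rowForm x y z (g.symm t)) h2
    simp only [map_add, map_smul, hg', hv, g.symm_apply_apply,
      smul_eq_mul, mul_zero, zero_add] at h3
    exact h3.symm
  · rintro ⟨b, c, rfl⟩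
    exact ⟨b • g.symm (0, ![1, 0]) + c • g.symm (0, ![0, 1]),
      by simp only [map_add, map_smul, smul_eq_mul]⟩

theorem exists_span_triple_eq_span_pair
    (hA : ∀ x : Fin 3 → FractionRing A, ¬ AlgebraicIndependent k x) (hev : ∀ q, ev (ι q) = q)
    (hker : ∀ a, ev a = 0 ↔ a ∈ Ideal.span {y, z}) (hn : 1 ≤ n) (hzn : z ^ n = y * B)
    (hB : (ev B).eval 1 ≠ 0) (hy : y ≠ 0) (hz : z ≠ 0)
    (hyz : ∀ e, z * e ∈ Ideal.span {y} → e ∈ Ideal.span {y, z ^ (n - 1)}) :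
    ∃ g h, Ideal.span {ι (X - 1), y, z} = Ideal.span {g, h} := by
  obtain ⟨e⟩ := (stablyIso_ker_rowForm_prod_self hev hker hn hzn hB hy hz hyz).nonempty_equiv hA
    (rank_ker_rowForm hz)
  have hgen : ∀ u, rowForm (ι (X - 1)) y z u = 0 → ∃ a b : A,
      u = a • (e.symm ![1, 0]).1 + b • (e.symm ![0, 1]).1 := by
    intro u hu
    obtain ⟨u', hu'⟩ : ∃ u' : LinearMap.ker (rowForm (ι (X - 1)) y z), u'.1 = u := ⟨⟨u, hu⟩, rfl⟩
    refine ⟨e u' 0, e u' 1, ?_⟩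
    have h2 : e u' = e u' 0 • ![1, 0] + e u' 1 • ![0, 1] := by
      ext i; fin_cases i <;> simp
    have h3 := congrArg (fun t => (e.symm t).1) h2
    simp only [map_add, map_smul, e.symm_apply_apply] at h3
    rw [← hu', h3]; rfl
  obtain ⟨a, b, hab⟩ := hgen (0, ![B, -z ^ (n - 1)]) (by
    have : z ^ n = z ^ (n - 1) * z := by rw [← pow_succ]; congr 1; omega
    simp only [rowForm_apply, Matrix.cons_val_zero, Matrix.cons_val_one]
    linear_combination this - hzn)
  by_cases h0 : (ev ((e.symm ![1, 0]).1.2 0)).eval 1 = 0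
  · have h1 : (ev ((e.symm ![0, 1]).1.2 0)).eval 1 ≠ 0 := by
      intro h1
      have h2 := congrArg (fun t : A × (Fin 2 → A) => (ev (t.2 0)).eval 1) hab
      simp [h0, h1] at h2
      exact hB h2
    refine exists_span_triple_eq_span_pair_of_basis (w := (e.symm ![1, 0]).1) hA hev hker
      (e.symm ![0, 1]).2
      (fun u hu => ?_) h1
    obtain ⟨a, b, h⟩ := hgen u hu
    exact ⟨b, a, by rw [h, add_comm]⟩
  · exact exists_span_triple_eq_span_pair_of_basis hA hev hker (e.symm ![1, 0]).2 hgen h0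

end LineOnSurface

section CyclicSurface

open Polynomial

variable {k : Type u} [Field k] {n : ℕ} {G B : (MvPolynomial (Fin 2) k)[X]}

theorem not_mem_span_X_one {p : MvPolynomial (Fin 2) k} (hp : MvPolynomial.eval ![1, 0] p ≠ 0) :
    ¬ (MvPolynomial.X 1 ∣ p) := by
  rintro ⟨q, rfl⟩
  simp at hp

theorem monic_of_eq_pow_sub (hG : G = X ^ n - C (MvPolynomial.X 1) * B)
    (hdeg : B.degree < n) : G.Monic := by
  rw [hG]
  refine monic_X_pow_sub ?_
  refine (degree_C_mul (MvPolynomial.X_ne_zero (R := k) (1 : Fin 2))).trans_lt hdeg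

theorem natDegree_of_eq_pow_sub (hG : G = X ^ n - C (MvPolynomial.X 1) * B)
    (hdeg : B.degree < n) : G.natDegree = n := by
  rw [hG]
  apply natDegree_eq_of_degree_eq_some
  rw [degree_sub_eq_left_of_degree_lt, degree_X_pow]
  rw [degree_X_pow]
  exact (degree_C_mul (MvPolynomial.X_ne_zero (R := k) (1 : Fin 2))).trans_lt hdeg

theorem prime_of_eq_pow_sub (hn : 1 ≤ n) (hG : G = X ^ n - C (MvPolynomial.X 1) * B)
    (hdeg : B.degree < n) (hB : MvPolynomial.eval ![1, 0] (B.coeff 0) ≠ 0) : Prime G := by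
  have hmonic := monic_of_eq_pow_sub hG hdeg
  have hnat := natDegree_of_eq_pow_sub hG hdeg
  have hdegG : G.degree = n := by rw [degree_eq_natDegree hmonic.ne_zero, hnat]
  have hprime : Prime (MvPolynomial.X 1 : MvPolynomial (Fin 2) k) := MvPolynomial.X_prime
  rw [← UniqueFactorizationMonoid.irreducible_iff_prime]
  refine irreducible_of_eisenstein_criterion
    (P := Ideal.span {(MvPolynomial.X 1 : MvPolynomial (Fin 2) k)}) ?_ ?_ ?_ ?_ ?_
      hmonic.isPrimitive
  · rwa [Ideal.span_singleton_prime hprime.ne_zero]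
  · rw [hmonic.leadingCoeff, ← Ideal.ne_top_iff_one, Ne, Ideal.span_singleton_eq_top]
    exact hprime.not_isUnit
  · intro i hi
    rw [hdegG, Nat.cast_lt] at hi
    rw [hG, coeff_sub, coeff_X_pow, if_neg hi.ne, coeff_C_mul, Ideal.mem_span_singleton, zero_sub,
      dvd_neg]
    exact dvd_mul_right _ _
  · rw [hdegG]; exact_mod_cast hn
  · rw [hG, coeff_sub, coeff_X_pow, if_neg (by omega), coeff_C_mul, zero_sub,
      Ideal.span_singleton_pow, Ideal.mem_span_singleton, dvd_neg, pow_two]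
    intro h
    exact not_mem_span_X_one hB ((mul_dvd_mul_iff_left hprime.ne_zero).1 h)

theorem not_algebraicIndependent_fractionRing_adjoinRoot [IsDomain (AdjoinRoot G)]
    (hG : G.Monic) (hG1 : G.degree ≠ 0) (x : Fin 3 → FractionRing (AdjoinRoot G)) :
    ¬ AlgebraicIndependent k x := by
  intro hx
  have hinj : Function.Injective (algebraMap (MvPolynomial (Fin 2) k) (AdjoinRoot G)) :=
    AdjoinRoot.of.injective_of_degree_ne_zero hG1
  have : FaithfulSMul (MvPolynomial (Fin 2) k) (AdjoinRoot G) :=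
    (faithfulSMul_iff_algebraMap_injective _ _).2 hinj
  have : FaithfulSMul (MvPolynomial (Fin 2) k) (FractionRing (AdjoinRoot G)) := inferInstance
  have : Module.Finite (MvPolynomial (Fin 2) k) (AdjoinRoot G) := hG.finite_adjoinRoot
  have halg : Algebra.IsAlgebraic (MvPolynomial (Fin 2) k) (FractionRing (AdjoinRoot G)) := by
    have : Algebra.IsAlgebraic (MvPolynomial (Fin 2) k) (AdjoinRoot G) := inferInstance
    have : Module.IsTorsionFree (MvPolynomial (Fin 2) k) (FractionRing (AdjoinRoot G)) :=
      inferInstance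
    exact (IsFractionRing.isAlgebraic_iff' _ (AdjoinRoot G) _).1 inferInstance
  have h1 := trdeg_add_eq k (MvPolynomial (Fin 2) k) (A := FractionRing (AdjoinRoot G))
  have h2 := hx.lift_cardinalMk_le_trdeg
  rw [← h1, trdeg_eq_zero (R := MvPolynomial (Fin 2) k), MvPolynomial.trdeg_of_isDomain] at h2
  simp at h2
  norm_cast at h2

variable [IsAlgClosed k] [CharZero k]

theorem exists_span_triple_of_eq_pow_sub (hn : 1 ≤ n) (hG : G = X ^ n - C (MvPolynomial.X 1) * B)
    (hdeg : B.degree < n) (hB : MvPolynomial.eval ![1, 0] (B.coeff 0) ≠ 0) :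
    ∃ g h, Ideal.span {G, g, h} =
      Ideal.span {C (MvPolynomial.X 0) - 1, C (MvPolynomial.X 1), X} := by
  have hmonic := monic_of_eq_pow_sub hG hdeg
  have hnat := natDegree_of_eq_pow_sub hG hdeg
  have hdegG : G.degree = n := by rw [degree_eq_natDegree hmonic.ne_zero, hnat]
  have hG1 : G.degree ≠ 0 := by rw [hdegG]; exact_mod_cast (by omega : n ≠ 0)
  have hprime : Prime (MvPolynomial.X 1 : MvPolynomial (Fin 2) k) := MvPolynomial.X_prime
  have : IsDomain (AdjoinRoot G) :=
    AdjoinRoot.isDomain_of_prime (prime_of_eq_pow_sub hn hG hdeg hB)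
  have hinj : Function.Injective (AdjoinRoot.of G) :=
    AdjoinRoot.of.injective_of_degree_ne_zero hG1
  let i : MvPolynomial (Fin 2) k →ₐ[k] k[X] := MvPolynomial.aeval ![X, 0]
  let ev : AdjoinRoot G →ₐ[k] k[X] := AdjoinRoot.liftAlgHom G i 0 (by
    rw [hG]; simp [show n ≠ 0 by omega, i])
  let ι : k[X] →ₐ[k] AdjoinRoot G := aeval (AdjoinRoot.of G (MvPolynomial.X 0))
  set y := AdjoinRoot.of G (MvPolynomial.X 1) with hy
  set z := AdjoinRoot.root G with hz
  have hevx : ev (AdjoinRoot.of G (MvPolynomial.X 0)) = X := by simp [ev, i]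
  have hevy : ev y = 0 := by simp [ev, i, y]
  have hevz : ev z = 0 := by simp [ev, z]
  have hev : ∀ q, ev (ι q) = q := by
    have : ev.comp ι = AlgHom.id k _ := by
      ext; simp [ι, hevx]
    exact fun q => DFunLike.congr_fun this q
  have hker : ∀ a, ev a = 0 ↔ a ∈ Ideal.span {y, z} := by
    have h1 : ((Ideal.Quotient.mkₐ k (Ideal.span {y, z})).comp (ι.comp ev)) =
        Ideal.Quotient.mkₐ k (Ideal.span {y, z}) := by
      have hy0 : Ideal.Quotient.mk (Ideal.span {y, z}) y = 0 :=
        Ideal.Quotient.eq_zero_iff_mem.2 (Ideal.subset_span (by simp))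
      have hz0 : Ideal.Quotient.mk (Ideal.span {y, z}) z = 0 :=
        Ideal.Quotient.eq_zero_iff_mem.2 (Ideal.subset_span (by simp))
      refine AdjoinRoot.algHom_ext' (MvPolynomial.algHom_ext fun j => ?_) ?_
      · fin_cases j
        · simp [ι, hevx]
        · simp [← hy, hevy, hy0]
      · simp [← hz, hevz, hz0]
    intro a
    constructor
    · intro ha
      have := DFunLike.congr_fun h1 a
      rw [← Ideal.Quotient.eq_zero_iff_mem]
      simpa [ha] using this.symm
    · intro ha
      obtain ⟨b, c, rfl⟩ := Ideal.mem_span_pair.1 ha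
      simp [hevy, hevz]
  have hzn : z ^ n = y * AdjoinRoot.mk G B := by
    have h1 : AdjoinRoot.mk G (X ^ n - C (MvPolynomial.X 1) * B) = 0 := by
      rw [← hG]; exact AdjoinRoot.mk_self
    simpa [sub_eq_zero] using h1
  have hB1 : (ev (AdjoinRoot.mk G B)).eval 1 ≠ 0 := by
    have h1 : (evalRingHom (1 : k)).comp i.toRingHom = MvPolynomial.eval ![1, 0] := by
      apply MvPolynomial.ringHom_ext
      · intro r; simp [i]
      · intro j; fin_cases j <;> simp [i]
    have h2 := RingHom.congr_fun h1 (B.coeff 0)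
    rw [← h2] at hB
    convert hB using 1
    simp [ev, eval₂_at_zero]
  have hy0 : y ≠ 0 := fun h => hprime.ne_zero (hinj (by rw [map_zero, ← h]))
  have hz0 : z ≠ 0 := by
    intro h
    rw [h, zero_pow (by omega), eq_comm, mul_eq_zero] at hzn
    rw [hzn.resolve_left hy0] at hB1
    simp at hB1
  have hyz : ∀ e, z * e ∈ Ideal.span {y} → e ∈ Ideal.span {y, z ^ (n - 1)} := by
    intro e he
    obtain ⟨d, hd⟩ := Ideal.mem_span_singleton'.1 he
    obtain ⟨e, rfl⟩ := AdjoinRoot.mk_surjective e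
    obtain ⟨d, rfl⟩ := AdjoinRoot.mk_surjective d
    have h1 : AdjoinRoot.mk G (X * e - C (MvPolynomial.X 1) * d) = 0 := by
      simp only [map_sub, map_mul, AdjoinRoot.mk_X, AdjoinRoot.mk_C]
      rw [← hz, ← hy, ← hd]; ring
    obtain ⟨g, hg⟩ := AdjoinRoot.mk_eq_zero.1 h1
    have hpow : (X ^ n : (MvPolynomial (Fin 2) k)[X]) = X * X ^ (n - 1) := by
      rw [← pow_succ']; congr 1; omega
    have h2 : C (MvPolynomial.X 1) ∣ X * (e - X ^ (n - 1) * g) :=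
      ⟨d - B * g, by rw [hG, hpow] at hg; linear_combination hg⟩
    have h3 : ¬ (C (MvPolynomial.X 1 : MvPolynomial (Fin 2) k)) ∣ X := by
      rw [C_dvd_iff_dvd_coeff]
      intro h
      have := h 1
      rw [coeff_X_one] at this
      exact hprime.not_isUnit (isUnit_of_dvd_one this)
    obtain ⟨w, hw⟩ := ((prime_C_iff.2 hprime).dvd_or_dvd h2).resolve_left h3
    refine Ideal.mem_span_pair.2 ⟨AdjoinRoot.mk G w, AdjoinRoot.mk G g, ?_⟩
    have h4 := congrArg (AdjoinRoot.mk G) hw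
    simp only [map_sub, map_mul, map_pow, AdjoinRoot.mk_X, AdjoinRoot.mk_C] at h4
    rw [← hz, ← hy] at h4
    linear_combination -h4
  obtain ⟨g, h, hgh⟩ := exists_span_triple_eq_span_pair (k := k)
    (not_algebraicIndependent_fractionRing_adjoinRoot hmonic hG1) hev hker hn hzn hB1 hy0 hz0 hyz
  obtain ⟨g, rfl⟩ := AdjoinRoot.mk_surjective g
  obtain ⟨h, rfl⟩ := AdjoinRoot.mk_surjective h
  refine ⟨g, h, ?_⟩
  have hcomap : ∀ S : Set (MvPolynomial (Fin 2) k)[X],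
      (Ideal.span (AdjoinRoot.mk G '' S)).comap (AdjoinRoot.mk G) =
      Ideal.span S ⊔ Ideal.span {G} := by
    intro S
    rw [← Ideal.map_span, Ideal.comap_map_of_surjective _ AdjoinRoot.mk_surjective]
    congr 1
    ext a
    rw [Ideal.mem_comap, Ideal.mem_bot, AdjoinRoot.mk_eq_zero, Ideal.mem_span_singleton]
  have h1 := hcomap {g, h}
  have h2 := hcomap {C (MvPolynomial.X 0) - 1, C (MvPolynomial.X 1), X}
  simp only [Set.image_insert_eq, Set.image_singleton, map_sub, map_one, AdjoinRoot.mk_X,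
    AdjoinRoot.mk_C] at h1 h2
  rw [← hz, ← hy] at h2
  have h3 : ι (X - 1) = AdjoinRoot.of G (MvPolynomial.X 0) - 1 := by simp [ι]
  rw [h3] at hgh
  rw [← hgh, h2] at h1
  rw [Ideal.span_insert, sup_comm, ← h1, sup_eq_left, Ideal.span_singleton_le_iff_mem, hG]
  refine Ideal.sub_mem _ (Ideal.pow_mem_of_mem _ (Ideal.subset_span (by simp)) _ (by omega))
    (Ideal.mul_mem_right _ _ (Ideal.subset_span (by simp)))

end CyclicSurface

section CommonZeros

open MvPolynomial

variable {K : Type v} [Field K]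

theorem le_height_of_isMaximal_mvPolynomial {N : ℕ} (P : Ideal (MvPolynomial (Fin N) K))
    [hP : P.IsMaximal] : (N : ℕ∞) ≤ P.height := by
  induction N with
  | zero => simp
  | succ N ih =>
    let e := (finSuccEquiv K N).toRingEquiv
    have hmax : (P.map e).IsMaximal := Ideal.map_isMaximal_of_equiv e
    have h1 : (P.map e).height = P.height := e.height_map P
    have h2 : ((P.map e).comap Polynomial.C).IsMaximal :=
      Polynomial.isMaximal_comap_C_of_isJacobsonRing _
    have h4 : (P.map e).LiesOver ((P.map e).comap Polynomial.C) := ⟨rfl⟩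
    have h3 := Polynomial.height_eq_height_add_one ((P.map e).comap Polynomial.C) (P.map e)
    rw [← h1, h3, Nat.cast_add, Nat.cast_one]
    gcongr
    exact ih _

variable [IsAlgClosed K]

theorem exists_ne_zero_forall_eval_eq_zero {N M : ℕ} (q : Fin M → MvPolynomial (Fin N) K)
    (h0 : ∀ i, eval 0 (q i) = 0) (hMN : M < N) : ∃ x ≠ 0, ∀ i, eval x (q i) = 0 := by
  by_contra! h
  have h1 : zeroLocus K (Ideal.span (Set.range q)) = {0} := by
    ext x
    rw [zeroLocus_span]
    simp only [Set.mem_range, forall_exists_index, forall_apply_eq_imp_iff, Set.mem_ofPred_eq,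
      Set.mem_singleton_iff, aeval_eq_eval]
    refine ⟨fun hx => ?_, fun hx i => hx ▸ h0 i⟩
    by_contra hx0
    obtain ⟨i, hi⟩ := h x hx0
    exact hi (hx i)
  have h2 := vanishingIdeal_zeroLocus_eq_radical (k := K) (K := K) (Ideal.span (Set.range q))
  rw [h1] at h2
  have h3 := le_height_of_isMaximal_mvPolynomial (vanishingIdeal K {(0 : Fin N → K)})
  have h4 : vanishingIdeal K {(0 : Fin N → K)} ∈ (Ideal.span (Set.range q)).minimalPrimes := by
    rw [← Ideal.radical_minimalPrimes, ← h2, Ideal.minimalPrimes_eq_subsingleton_self]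
    rfl
  have h5 := Ideal.height_le_card_of_mem_minimalPrimes_span (Set.finite_range q) h4
  have h6 : (Set.range q).ncard ≤ M := by
    simpa [Set.ncard_univ] using Set.ncard_image_le (s := Set.univ) (f := q)
  have h7 : (N : ℕ∞) ≤ M := h3.trans (h5.trans (by exact_mod_cast h6))
  norm_cast at h7
  omega

theorem one_mem_span_of_forall_exists_eval_ne_zero {σ ι : Type*} [Finite σ]
    (q : ι → MvPolynomial σ K) (h : ∀ x, ∃ i, eval x (q i) ≠ 0) :
    (1 : MvPolynomial σ K) ∈ Ideal.span (Set.range q) := by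
  rw [← Ideal.eq_top_iff_one]
  by_contra hne
  obtain ⟨M, hM, hle⟩ := Ideal.exists_le_maximal _ hne
  obtain ⟨x, rfl⟩ := isMaximal_iff_eq_vanishingIdeal_singleton.1 hM
  obtain ⟨i, hi⟩ := h x
  exact hi (by simpa using hle (Ideal.subset_span (Set.mem_range_self i)))

end CommonZeros

section Evaluation

open MvPolynomial

variable {K : Type v} [CommRing K] {σ : Type*}

theorem sub_mem_span_of_aeval {S : Type*} [CommRing S] [Algebra K S] {I : Ideal S}
    {φ ψ : MvPolynomial σ K →ₐ[K] S} (h : ∀ i, φ (X i) - ψ (X i) ∈ I) (g : MvPolynomial σ K) :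
    φ g - ψ g ∈ I := by
  have : (Ideal.Quotient.mkₐ K I).comp φ = (Ideal.Quotient.mkₐ K I).comp ψ := by
    ext i
    simpa [Ideal.Quotient.eq] using h i
  have h1 := DFunLike.congr_fun this g
  simpa [Ideal.Quotient.eq] using h1

theorem ker_eval_eq_span (e : σ → K) :
    RingHom.ker (eval e) = Ideal.span (Set.range fun i => X i - C (e i)) := by
  apply le_antisymm
  · intro g hg
    have h1 := sub_mem_span_of_aeval (I := Ideal.span (Set.range fun i => X i - C (e i)))
      (φ := AlgHom.id K _) (ψ := aeval fun i => C (e i))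
      (fun i => Ideal.subset_span ⟨i, by simp⟩) g
    have h2 : aeval (fun i => C (e i)) g = (C (eval e g) : MvPolynomial σ K) :=
      aeval_algebraMap_apply (MvPolynomial σ K) e g
    rw [h2, (RingHom.mem_ker).1 hg] at h1
    simpa using h1
  · rw [Ideal.span_le]
    rintro _ ⟨i, rfl⟩
    simp

end Evaluation

section LinearSlice

open MvPolynomial

variable {K : Type v} [Field K]

theorem range_fin_append {α : Type*} {m n : ℕ} (u : Fin m → α) (v : Fin n → α) :
    Set.range (Fin.append u v) = Set.range u ∪ Set.range v := by
  ext a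
  constructor
  · rintro ⟨i, rfl⟩
    refine Fin.addCases (fun i => ?_) (fun i => ?_) i <;> simp
  · rintro (⟨i, rfl⟩ | ⟨i, rfl⟩)
    · exact ⟨Fin.castAdd n i, by simp⟩
    · exact ⟨Fin.natAdd m i, by simp⟩

noncomputable def linearSlice {m r : ℕ} (b : Fin r → Fin m → K) :
    MvPolynomial (Fin m) K →ₐ[K] MvPolynomial (Fin r) K :=
  aeval fun i => ∑ j, C (b j i) * X j

theorem eval_linearSlice {m r : ℕ} (b : Fin r → Fin m → K) (e : Fin r → K)
    (g : MvPolynomial (Fin m) K) : eval e (linearSlice b g) = eval (∑ j, e j • b j) g := by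
  have : (aeval e).comp (linearSlice b) = aeval (∑ j, e j • b j) := by
    ext i
    simp [linearSlice, mul_comm]
  exact DFunLike.congr_fun this g

theorem linearSlice_isHomogeneous {m r n : ℕ} (b : Fin r → Fin m → K)
    {g : MvPolynomial (Fin m) K} (hg : g.IsHomogeneous n) : (linearSlice b g).IsHomogeneous n := by
  have := hg.aeval (fun i => ∑ j, C (b j i) * X j) (n := 1) (fun i =>
    IsHomogeneous.sum _ _ _ fun j _ => (isHomogeneous_X K j).C_mul _)
  rwa [one_mul] at this

theorem exists_ker_linearSlice_eq_span {m r s : ℕ} (hm : r + s = m) {b : Fin r → Fin m → K}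
    (hb : LinearIndependent K b) :
    ∃ l : Fin s → MvPolynomial (Fin m) K, RingHom.ker (linearSlice b) = Ideal.span (Set.range l) ∧
      Function.Surjective (linearSlice b) ∧
      ∀ x, (∀ i, eval x (l i) = 0) → ∃ e : Fin r → K, x = ∑ j, e j • b j := by
  let β := Module.Basis.sumExtend hb
  have hβ : ∀ j, β (Sum.inl j) = b j := fun j => by
    simp only [β, Module.Basis.sumExtend, Module.Basis.reindex_apply,
      Module.Basis.extend_apply_self]
    rfl
  have : Finite (Fin r ⊕ Module.Basis.sumExtendIndex hb) := Module.Finite.finite_basis β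
  have : Finite (Module.Basis.sumExtendIndex hb) := 
    Finite.of_injective (Sum.inr : _ → Fin r ⊕ Module.Basis.sumExtendIndex hb) Sum.inr_injective
  have : Fintype (Module.Basis.sumExtendIndex hb) := Fintype.ofFinite _
  have hcard : Fintype.card (Module.Basis.sumExtendIndex hb) = s := by
    have h1 := Module.finrank_eq_card_basis β
    rw [Module.finrank_fin_fun, Fintype.card_sum, Fintype.card_fin] at h1
    omega
  let ε := (Fintype.equivFinOfCardEq hcard).symm
  let L : (Fin r ⊕ Module.Basis.sumExtendIndex hb) → MvPolynomial (Fin m) K :=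
    fun j => ∑ i, C (β.coord j (Pi.single i 1)) * X i
  have hL : ∀ j x, eval x (L j) = β.coord j x := by
    intro j x
    conv_rhs => rw [← Finset.univ_sum_single x]
    simp only [L, map_sum, map_mul, eval_C, eval_X]
    refine Finset.sum_congr rfl fun i _ => ?_
    have h1 : (Pi.single i (x i) : Fin m → K) = x i • Pi.single i 1 := by
      rw [← Pi.single_smul, smul_eq_mul, mul_one]
    rw [h1, map_smul, smul_eq_mul, mul_comm]
  have hφL : ∀ j, linearSlice b (L j) = Sum.elim X 0 j := by
    intro j
    have h1 : linearSlice b (L j) = ∑ j', C (β.coord j (b j')) * X j' := by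
      simp only [L, map_sum, map_mul, linearSlice, aeval_X, algHom_C, algebraMap_eq,
        Finset.mul_sum]
      rw [Finset.sum_comm]
      refine Finset.sum_congr rfl fun j' _ => ?_
      rw [← hL]
      simp only [L, map_sum, map_mul, eval_C, eval_X, Finset.sum_mul]
      exact Finset.sum_congr rfl fun i _ => by ring
    rw [h1]
    simp only [← hβ, Module.Basis.coord_apply, Module.Basis.repr_self]
    rcases j with j | j
    · rw [Finset.sum_eq_single j]
      · simp
      · intro i _ hi
        simp [hi]
      · simp
    · simp
  refine ⟨fun i => L (Sum.inr (ε i)), ?_, ?_, ?_⟩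
  · apply le_antisymm
    · intro g hg
      let ψ : MvPolynomial (Fin r) K →ₐ[K] MvPolynomial (Fin m) K := aeval fun j => L (Sum.inl j)
      have h1 := sub_mem_span_of_aeval (φ := AlgHom.id K _) (ψ := ψ.comp (linearSlice b))
        (I := Ideal.span (Set.range fun i => L (Sum.inr (ε i)))) (fun i => ?_) g
      · have : linearSlice b g = 0 := hg
        simpa [this] using h1
      · have h2 : (X i : MvPolynomial (Fin m) K) = ∑ j, C (β j i) * L j := by
          have h3 : ∀ i', ∑ j, β j i * β.coord j (Pi.single i' 1) = if i' = i then 1 else 0 := by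
            intro i'
            have h4 := congrFun (β.sum_repr (Pi.single i' (1 : K))) i
            simp only [Finset.sum_apply, Pi.smul_apply, smul_eq_mul] at h4
            simp only [Module.Basis.coord_apply]
            rw [Pi.single_apply] at h4
            simp only [mul_comm (β _ i), h4, eq_comm]
          simp only [L, Finset.mul_sum]
          rw [Finset.sum_comm]
          simp_rw [← mul_assoc, ← C_mul, ← Finset.sum_mul, ← map_sum, h3]
          simp
        rw [Fintype.sum_sum_type] at h2
        have h5 : ψ (linearSlice b (X i)) = ∑ j, C (b j i) * L (Sum.inl j) := by
          simp [ψ, linearSlice]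
        simp only [AlgHom.id_apply, AlgHom.comp_apply, h5]
        rw [h2]
        simp only [hβ, add_sub_cancel_left]
        refine Ideal.sum_mem _ fun j _ => Ideal.mul_mem_left _ _ (Ideal.subset_span ⟨ε.symm j, ?_⟩)
        simp
    · rw [Ideal.span_le]
      rintro _ ⟨i, rfl⟩
      exact hφL (Sum.inr (ε i))
  · intro g
    refine ⟨aeval (fun j => L (Sum.inl j)) g, ?_⟩
    have : (linearSlice b).comp (aeval (fun j => L (Sum.inl j))) = AlgHom.id K _ := by
      ext j
      simp [hφL]
    exact DFunLike.congr_fun this g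
  · intro x hx
    refine ⟨fun j => β.coord (Sum.inl j) x, ?_⟩
    conv_lhs => rw [← β.sum_repr x, Fintype.sum_sum_type]
    have : ∀ j, β.repr x (Sum.inr j) = 0 := fun j => by
      have := hx (ε.symm j)
      rw [hL] at this
      simpa using this
    simp [this, hβ]

theorem ker_eval_sum_eq_span_of_ker_eval_eq_span {m r s t : ℕ} (hm : r + s = m)
    {b : Fin r → Fin m → K} (hb : LinearIndependent K b) {f : MvPolynomial (Fin m) K}
    (e : Fin r → K) (g : Fin t → MvPolynomial (Fin r) K)
    (hg : RingHom.ker (eval e) = Ideal.span ({linearSlice b f} ∪ Set.range g)) :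
    ∃ g' : Fin (t + s) → MvPolynomial (Fin m) K,
      RingHom.ker (eval (∑ j, e j • b j)) = Ideal.span ({f} ∪ Set.range g') := by
  obtain ⟨l, hker, hsurj, -⟩ := exists_ker_linearSlice_eq_span hm hb
  choose g' hg' using fun i => hsurj (g i)
  refine ⟨Fin.append g' l, ?_⟩
  have h1 : RingHom.ker (eval (∑ j, e j • b j)) =
      (RingHom.ker (eval e)).comap (linearSlice b) := by
    ext a
    simp [RingHom.mem_ker, eval_linearSlice]
  have h2 : {linearSlice b f} ∪ Set.range g = linearSlice b '' ({f} ∪ Set.range g') := by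
    rw [Set.image_union, Set.image_singleton, ← Set.range_comp]
    congr 2
    ext i : 1
    exact (hg' i).symm
  have h3 : Set.range (Fin.append g' l) = Set.range g' ∪ Set.range l := range_fin_append g' l
  rw [h1, hg, h2, ← Ideal.map_span, Ideal.comap_map_of_surjective _ hsurj, h3, ← Set.union_assoc,
    Ideal.span_union _ (Set.range l), ← hker]
  rfl

end LinearSlice

section Homogeneous

open MvPolynomial

variable {K : Type v} [Field K] {σ : Type*}

theorem MvPolynomial.IsHomogeneous.eval_smul' {n : ℕ} {f : MvPolynomial σ K}
    (hf : f.IsHomogeneous n) (t : K) (x : σ → K) : eval (t • x) f = t ^ n * eval x f := by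
  rw [eval_eq, eval_eq, Finset.mul_sum]
  refine Finset.sum_congr rfl fun d hd => ?_
  have hdeg : ∑ i ∈ d.support, d i = n := by
    rw [← hf (mem_support_iff.1 hd), Finsupp.weight_apply, Finsupp.sum]
    simp
  simp only [Pi.smul_apply, smul_eq_mul, mul_pow, Finset.prod_mul_distrib,
    Finset.prod_pow_eq_pow_sum,
    hdeg]
  ring

theorem eq_C_mul_X_pow_of_eval [Infinite K] {n : ℕ} {q : MvPolynomial (Fin 2) K}
    (hq : q.IsHomogeneous n) {c : K} (h : ∀ s, eval ![1, s] q = c * s ^ n) : q = C c * X 1 ^ n := by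
  rw [← sub_eq_zero]
  have h1 : X 0 * (q - C c * X 1 ^ n) = 0 := by
    refine MvPolynomial.funext fun x => ?_
    by_cases hx : x 0 = 0
    · simp [hx]
    have h2 : x = x 0 • ![1, x 1 / x 0] := by
      ext i
      fin_cases i
      · simp
      · simp [mul_div_cancel₀ _ hx]
    have h3 := hq.eval_smul' (x 0) ![1, x 1 / x 0]
    rw [← h2, h, div_pow] at h3
    simp only [map_mul, map_sub, eval_X, eval_C, map_pow, map_zero, h3]
    field_simp
    ring
  exact (mul_eq_zero.1 h1).resolve_left (X_ne_zero _)

theorem pderiv_linearSlice {m r : ℕ} (b : Fin r → Fin m → K) (j : Fin r)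
    (g : MvPolynomial (Fin m) K) :
    pderiv j (linearSlice b g) = ∑ i, C (b j i) * linearSlice b (pderiv i g) := by
  induction g using MvPolynomial.induction_on with
  | C a => simp [linearSlice]
  | add p q hp hq => simp [hp, hq, mul_add, Finset.sum_add_distrib]
  | mul_X p l hp =>
    have h1 : pderiv j (linearSlice b (X l)) = C (b j l) := by
      simp [linearSlice, pderiv_X, Pi.single_apply]
    have h2 : ∀ i, linearSlice b (pderiv i (X l : MvPolynomial (Fin m) K)) =
        if l = i then 1 else 0 := by
      intro i
      rw [pderiv_X, Pi.single_apply]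
      split_ifs <;> simp
    simp only [map_mul, Derivation.leibniz, smul_eq_mul, map_add, h1, h2, hp, mul_add,
      Finset.sum_add_distrib, Finset.mul_sum]
    congr 1
    · simp [mul_comm]
    · exact Finset.sum_congr rfl fun i _ => by ring

end Homogeneous

section CyclicSurface

open MvPolynomial

variable {K : Type v} [Field K] [IsAlgClosed K] [CharZero K] {n : ℕ}

theorem exists_ker_eval_eq_span_of_eq_add {c : K} (hc : c ≠ 0) {F B : MvPolynomial (Fin 3) K}
    (hn : 1 ≤ n) (hF : F = C c * X 0 ^ n + X 2 * B) (hdeg : B.totalDegree < n)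
    (hB : eval ![0, 1, 0] B ≠ 0) :
    ∃ g : Fin 2 → MvPolynomial (Fin 3) K,
      RingHom.ker (eval ![(0 : K), 1, 0]) = Ideal.span ({F} ∪ Set.range g) := by
  let E : MvPolynomial (Fin 3) K ≃ₐ[K] Polynomial (MvPolynomial (Fin 2) K) := finSuccEquiv K 2
  have hE0 : E (X 0) = Polynomial.X := finSuccEquiv_X_zero
  have hE1 : E (X 1) = Polynomial.C (X 0) := finSuccEquiv_X_succ (j := 0)
  have hE2 : E (X 2) = Polynomial.C (X 1) := finSuccEquiv_X_succ (j := 1)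
  have hEC : ∀ a, E (C a) = Polynomial.C (C a) := fun a => by
    rw [← RingHom.congr_fun (finSuccEquiv_comp_C_eq_C 2) a]
    exact E.apply_symm_apply _
  set B' := E (-C c⁻¹ * B) with hB'
  have hdeg' : B'.degree < n := by
    refine (Polynomial.degree_le_natDegree).trans_lt ?_
    rw [hB', natDegree_finSuccEquiv, Nat.cast_lt]
    refine (degreeOf_le_totalDegree _ _).trans_lt (lt_of_le_of_lt ?_ hdeg)
    rw [← C_neg]
    exact (totalDegree_mul _ _).trans (by simp)
  have hBe : eval ![(1 : K), 0] (B'.coeff 0) ≠ 0 := by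
    have h1 := eval_eq_eval_mv_eval' ![(1 : K), 0] 0 (-C c⁻¹ * B)
    rw [← Polynomial.coeff_zero_eq_eval_zero, Polynomial.coeff_map] at h1
    change _ = eval ![(1 : K), 0] (B'.coeff 0) at h1
    rw [← h1]
    simp only [map_mul, map_neg, eval_C]
    exact mul_ne_zero (neg_ne_zero.2 (inv_ne_zero hc)) hB
  obtain ⟨g, h, hgh⟩ := exists_span_triple_of_eq_pow_sub hn rfl hdeg' hBe
  have hEF : E F = Polynomial.C (C c) *
      (Polynomial.X ^ n - Polynomial.C (X 1) * B') := by
    have h1 : (Polynomial.C (C c) * Polynomial.C (C c⁻¹) :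
        Polynomial (MvPolynomial (Fin 2) K)) = 1 := by
      rw [← Polynomial.C_mul, ← C_mul, mul_inv_cancel₀ hc, C_1, Polynomial.C_1]
    rw [hF, hB']
    simp only [map_add, map_mul, map_pow, map_neg, hE0, hE2, hEC]
    linear_combination (-Polynomial.C (X 1) * E B) * h1
  have hunit : IsUnit (Polynomial.C (C c : MvPolynomial (Fin 2) K)) :=
    ((isUnit_iff_ne_zero.2 hc).map C).map Polynomial.C
  refine ⟨![E.symm g, E.symm h], ?_⟩
  let E' : MvPolynomial (Fin 3) K →+* Polynomial (MvPolynomial (Fin 2) K) :=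
    RingHomClass.toRingHom E
  have hE' : ∀ a, E' a = E a := fun _ => rfl
  have hinj : Function.Injective (Ideal.map E') := by
    intro I J hIJ
    have := congrArg (Ideal.comap E') hIJ
    rwa [Ideal.comap_map_of_bijective E' E.bijective,
      Ideal.comap_map_of_bijective E' E.bijective]
      at this
  apply hinj
  rw [ker_eval_eq_span, Ideal.map_span, Ideal.map_span]
  have h1 : E' '' ({F} ∪ Set.range ![E.symm g, E.symm h]) =
      {E F, g, h} := by
    rw [Matrix.range_cons, Matrix.range_cons, Matrix.range_empty, Set.union_empty,
      Set.image_union, Set.image_union, Set.image_singleton, Set.image_singleton,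
      Set.image_singleton, hE', hE', hE', E.apply_symm_apply, E.apply_symm_apply]
    rfl
  have h2 : E' ''
      (Set.range fun i => X i - C (![(0 : K), 1, 0] i)) =
      {Polynomial.C (X 0) - 1, Polynomial.C (X 1), Polynomial.X} := by
    rw [← Set.range_comp]
    ext a
    simp only [Set.mem_range, Function.comp_apply, Fin.exists_fin_succ, hE', map_sub, hEC,
      Fin.succ_zero_eq_one, Fin.succ_one_eq_two, hE0, hE1, hE2, IsEmpty.exists_iff, or_false,
      Set.mem_insert_iff, Set.mem_singleton_iff, Matrix.cons_val]
    simp only [map_zero, map_one, sub_zero, eq_comm (b := a)]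
    rw [or_comm, or_assoc]
  rw [h1, h2, ← hgh, hEF, Ideal.span_insert, Ideal.span_insert (_ * _),
    Ideal.span_singleton_mul_left_unit hunit]

end CyclicSurface

section DeterminantTrick

theorem Ideal.span_insert_pair_eq_span_of_sum_mul {R ι : Type*} [CommRing R] [Fintype ι]
    (x y : R) (l B c : ι → R)
    (h : 1 - ∑ i, c i * B i ∈ Ideal.span ({x} ∪ Set.range l)) :
    Ideal.span ({∑ i, B i * l i} ∪
      ({y * (∑ i, c i * B i) + (1 - ∑ i, c i * B i)} ∪ Set.range fun i => l i + c i * x)) =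
    Ideal.span ({x} ∪ ({y} ∪ Set.range l)) := by
  set δ := ∑ i, c i * B i with hδ
  set J := Ideal.span ({∑ i, B i * l i} ∪
      ({y * δ + (1 - δ)} ∪ Set.range fun i => l i + c i * x)) with hJ
  have hsum : ∑ i, B i * (l i + c i * x) = ∑ i, B i * l i + δ * x := by
    rw [hδ, Finset.sum_mul, ← Finset.sum_add_distrib]
    exact Finset.sum_congr rfl fun i _ => by ring
  apply le_antisymm
  · have hx : x ∈ Ideal.span ({x} ∪ ({y} ∪ Set.range l)) := Ideal.subset_span (by simp)
    have hy : y ∈ Ideal.span ({x} ∪ ({y} ∪ Set.range l)) := Ideal.subset_span (by simp)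
    have hl : ∀ i, l i ∈ Ideal.span ({x} ∪ ({y} ∪ Set.range l)) :=
      fun i => Ideal.subset_span (by simp)
    have h1 : 1 - δ ∈ Ideal.span ({x} ∪ ({y} ∪ Set.range l)) :=
      Ideal.span_mono (by grind) h
    rw [hJ, Ideal.span_le]
    rintro _ (rfl | rfl | ⟨i, rfl⟩)
    · exact Ideal.sum_mem _ fun i _ => Ideal.mul_mem_left _ _ (hl i)
    · exact Ideal.add_mem _ (Ideal.mul_mem_right _ _ hy) h1
    · exact Ideal.add_mem _ (hl i) (Ideal.mul_mem_left _ _ hx)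
  · have hf : ∑ i, B i * l i ∈ J := Ideal.subset_span (by simp)
    have hh : y * δ + (1 - δ) ∈ J := Ideal.subset_span (by simp)
    have hg : ∀ i, l i + c i * x ∈ J := fun i => Ideal.subset_span (by simp)
    have hδx : δ * x ∈ J := by
      have : ∑ i, B i * (l i + c i * x) ∈ J :=
        Ideal.sum_mem _ fun i _ => Ideal.mul_mem_left _ _ (hg i)
      rw [hsum] at this
      exact (Ideal.add_mem_iff_right _ hf).1 this
    have hδl : ∀ i, δ * l i ∈ J := fun i => by
      have : δ * l i = δ * (l i + c i * x) - c i * (δ * x) := by ring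
      rw [this]
      exact Ideal.sub_mem _ (Ideal.mul_mem_left _ _ (hg i)) (Ideal.mul_mem_left _ _ hδx)
    have hδδ : δ * (1 - δ) ∈ J := by
      have h1 : Ideal.span ({x} ∪ Set.range l) ≤
          (Submodule.comap (LinearMap.mulLeft R δ) J : Ideal R) := by
        rw [Ideal.span_le]
        rintro _ (rfl | ⟨i, rfl⟩)
        · exact hδx
        · exact hδl i
      exact h1 h
    have hyδ : y * δ ∈ J := by
      have : y * δ = δ * (y * δ + (1 - δ)) + (y - 1) * (δ * (1 - δ)) := by ring
      rw [this]
      exact Ideal.add_mem _ (Ideal.mul_mem_left _ _ hh) (Ideal.mul_mem_left _ _ hδδ)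
    have h1δ : 1 - δ ∈ J := (Ideal.add_mem_iff_right _ hyδ).1 hh
    have key : ∀ a, δ * a ∈ J → a ∈ J := fun a ha => by
      have : a = δ * a + a * (1 - δ) := by ring
      rw [this]
      exact Ideal.add_mem _ ha (Ideal.mul_mem_left _ _ h1δ)
    rw [Ideal.span_le]
    rintro _ (rfl | rfl | ⟨i, rfl⟩)
    · exact key _ hδx
    · exact key _ (by rwa [mul_comm])
    · exact key _ (hδl i)

end DeterminantTrick

section Cases

open MvPolynomial

variable {K : Type v} [Field K] {m n : ℕ} {f : MvPolynomial (Fin m) K} {p w : Fin m → K}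

theorem exists_ker_eval_eq_span_of_eval_line_eq_mul [Infinite K] {s : ℕ} (hm : 2 + s = m)
    (hpv : LinearIndependent K ![p, w]) {c : K} (hc : c ≠ 0)
    (h : ∀ t, eval (p + t • w) f = c * t) :
    ∃ g : Fin (1 + s) → MvPolynomial (Fin m) K,
      RingHom.ker (eval p) = Ideal.span ({f} ∪ Set.range g) := by
  have h1 := ker_eval_sum_eq_span_of_ker_eval_eq_span hm hpv (f := f) ![1, 0] ![X 0 - 1] ?_
  · simpa using h1
  set q := linearSlice ![p, w] f with hq
  have h2 : (aeval ![1, X 1] q : MvPolynomial (Fin 2) K) = C c * X 1 := by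
    refine MvPolynomial.funext fun x => ?_
    have h3 : eval x (aeval ![1, X 1] q : MvPolynomial (Fin 2) K) = eval ![1, x 1] q := by
      have : (aeval x).comp (aeval ![1, X 1] : MvPolynomial (Fin 2) K →ₐ[K] _) =
          aeval ![1, x 1] := by
        ext i
        fin_cases i <;> simp
      exact DFunLike.congr_fun this q
    rw [h3, hq, eval_linearSlice]
    simpa using h (x 1)
  have h4 : q - C c * X 1 ∈ Ideal.span {(X 0 - 1 : MvPolynomial (Fin 2) K)} := by
    rw [← h2]
    refine sub_mem_span_of_aeval (φ := AlgHom.id K _) (fun i => ?_) q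
    fin_cases i
    · simp
    · simp
  rw [ker_eval_eq_span]
  have h5 : (Set.range fun i => X i - C (![(1 : K), 0] i)) =
      {(X 0 - 1 : MvPolynomial (Fin 2) K), X 1} := by
    ext a
    simp [Fin.exists_fin_succ, eq_comm]
  rw [h5, Matrix.range_cons, Matrix.range_empty, Set.union_empty]
  have h6 : (C c : MvPolynomial (Fin 2) K) * C c⁻¹ = 1 := by
    rw [← C_mul, mul_inv_cancel₀ hc, C_1]
  obtain ⟨a, ha⟩ := Ideal.mem_span_singleton'.1 h4
  apply le_antisymm <;> rw [Ideal.span_le]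
  · rintro _ (rfl | rfl)
    · exact Ideal.subset_span (by simp)
    · refine Ideal.mem_span_pair.2 ⟨C c⁻¹, - C c⁻¹ * a, ?_⟩
      linear_combination C c⁻¹ * -ha + X 1 * h6
  · rintro _ (rfl | rfl)
    · refine Ideal.mem_span_pair.2 ⟨a, C c, ?_⟩
      linear_combination ha
    · exact Ideal.subset_span (by simp)

theorem exists_ker_eval_eq_span_of_linearSlice_eq_zero [IsAlgClosed K] {s : ℕ} (hm : 2 + s = m)
    (hpv : LinearIndependent K ![p, w]) (h : linearSlice ![p, w] f = 0)
    (hsmooth : ∀ x, (∀ i, eval x (pderiv i f) = 0) → x = 0) :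
    ∃ g : Fin (1 + s) → MvPolynomial (Fin m) K,
      RingHom.ker (eval p) = Ideal.span ({f} ∪ Set.range g) := by
  obtain ⟨l, hker, hsurj, hl⟩ := exists_ker_linearSlice_eq_span hm hpv
  obtain ⟨B, hB⟩ : ∃ B : Fin s → MvPolynomial (Fin m) K, ∑ i, B i * l i = f := by
    have : f ∈ Ideal.span (Set.range l) := hker ▸ h
    exact (Ideal.mem_span_range_iff_exists_fun).1 this
  obtain ⟨x, hx⟩ := hsurj (X 0 - 1)
  obtain ⟨y, hy⟩ := hsurj (X 1)
  have hone : (1 : MvPolynomial (Fin m) K) ∈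
      Ideal.span (Set.range (Sum.elim B (Sum.elim l fun _ : Unit => x))) := by
    apply one_mem_span_of_forall_exists_eval_ne_zero
    by_contra! hz
    obtain ⟨z, hz⟩ := hz
    have hzB : ∀ i, eval z (B i) = 0 := fun i => hz (Sum.inl i)
    have hzl : ∀ i, eval z (l i) = 0 := fun i => hz (Sum.inr (Sum.inl i))
    have hzx : eval z x = 0 := hz (Sum.inr (Sum.inr ()))
    obtain ⟨e, he⟩ := hl z hzl
    have h1 : e 0 = 1 := by
      rw [he, ← eval_linearSlice, hx] at hzx
      simpa [sub_eq_zero] using hzx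
    have h2 : z = 0 := hsmooth z fun i => by
      simp [← hB, hzB, hzl]
    have h3 := Fintype.linearIndependent_iff.1 hpv e (by rw [← he, h2]) 0
    exact one_ne_zero (h1.symm.trans h3)
  obtain ⟨c, hc⟩ := (Ideal.mem_span_range_iff_exists_fun).1 hone
  have h1 : 1 - ∑ i, c (Sum.inl i) * B i ∈ Ideal.span ({x} ∪ Set.range l) := by
    rw [← hc, Fintype.sum_sum_type]
    simp only [Sum.elim_inl, add_sub_cancel_left, Fintype.sum_sum_type, Sum.elim_inr]
    refine Ideal.add_mem _ (Ideal.sum_mem _ fun i _ => ?_) (Ideal.sum_mem _ fun i _ => ?_) <;>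
    exact Ideal.mul_mem_left _ _ (Ideal.subset_span (by simp))
  have h2 := Ideal.span_insert_pair_eq_span_of_sum_mul x y l B _ h1
  rw [hB] at h2
  have h3 : RingHom.ker (eval p) = Ideal.span ({x} ∪ ({y} ∪ Set.range l)) := by
    have h4 : RingHom.ker (eval p) =
        (Ideal.span {(X 0 - 1 : MvPolynomial (Fin 2) K), X 1}).comap (linearSlice ![p, w]) := by
      have h5 : (Set.range fun i => X i - C (![(1 : K), 0] i)) =
          {(X 0 - 1 : MvPolynomial (Fin 2) K), X 1} := by
        ext a
        simp [Fin.exists_fin_succ, eq_comm]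
      rw [← h5, ← ker_eval_eq_span]
      ext a
      simp [RingHom.mem_ker, eval_linearSlice]
    have h6 : {(X 0 - 1 : MvPolynomial (Fin 2) K), X 1} = linearSlice ![p, w] '' {x, y} := by
      rw [Set.image_pair, hx, hy]
    rw [h4, h6, ← Ideal.map_span, Ideal.comap_map_of_surjective _ hsurj, ← Set.union_assoc,
      Ideal.span_union _ (Set.range l), ← hker]
    rfl
  rw [h3, ← h2]
  refine ⟨Fin.append ![y * ∑ i, c (Sum.inl i) * B i + (1 - ∑ i, c (Sum.inl i) * B i)]
    fun i => l i + c (Sum.inl i) * x, ?_⟩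
  rw [range_fin_append, Matrix.range_cons, Matrix.range_empty, Set.union_empty]

end Cases

section Lines

variable {K : Type v} [Field K] {m n : ℕ} {f : MvPolynomial (Fin m) K} {p : Fin m → K}

noncomputable def restrictLine (f : MvPolynomial (Fin m) K) (p w : Fin m → K) : Polynomial K :=
  MvPolynomial.aeval (fun i => Polynomial.C (w i) * Polynomial.X + Polynomial.C (p i)) f

theorem eval_restrictLine (f : MvPolynomial (Fin m) K) (p w : Fin m → K) (t : K) :
    (restrictLine f p w).eval t = MvPolynomial.eval (p + t • w) f := by
  have : (Polynomial.aeval t).comp (MvPolynomial.aeval fun i =>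
      Polynomial.C (w i) * Polynomial.X + Polynomial.C (p i)) = MvPolynomial.aeval (p + t • w) := by
    ext i
    simp
    ring
  exact DFunLike.congr_fun this f

theorem natDegree_restrictLine_le (hf : f.IsHomogeneous n) (p w : Fin m → K) :
    (restrictLine f p w).natDegree ≤ n := by
  have := MvPolynomial.aeval_natDegree_le f hf.totalDegree_le
    (fun i => Polynomial.C (w i) * Polynomial.X + Polynomial.C (p i))
    (fun i => Polynomial.natDegree_linear_le)
  rwa [mul_one] at this

theorem exists_restrictLine_eq_X_mul_pow [IsAlgClosed K] [CharZero K] (hf : f.IsHomogeneous n)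
    (hn : 2 ≤ n) (hnm : n ≤ m) (hfp : MvPolynomial.eval p f = 0) (i₀ : Fin m) :
    ∃ (y : Fin m → K) (a b : K), y ≠ 0 ∧ y i₀ = 0 ∧
      restrictLine f p y =
        Polynomial.X * (Polynomial.C b - Polynomial.C a * Polynomial.X) ^ (n - 1) := by
  let Q : Fin n → MvPolynomial (Fin (m + 2)) K := fun j =>
    MvPolynomial.aeval (fun i => MvPolynomial.C (p i) +
      MvPolynomial.C ((j : K) + 1) * MvPolynomial.X (Fin.castAdd 2 i)) f -
    MvPolynomial.C ((j : K) + 1) * (MvPolynomial.X (Fin.natAdd m 1) -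
      MvPolynomial.C ((j : K) + 1) * MvPolynomial.X (Fin.natAdd m 0)) ^ (n - 1)
  have hQ : ∀ j z, MvPolynomial.eval z (Q j) =
      MvPolynomial.eval (p + ((j : K) + 1) • fun i => z (Fin.castAdd 2 i)) f -
      ((j : K) + 1) * (z (Fin.natAdd m 1) - ((j : K) + 1) * z (Fin.natAdd m 0)) ^ (n - 1) := by
    intro j z
    have : (MvPolynomial.aeval z).comp (MvPolynomial.aeval (fun i => MvPolynomial.C (p i) +
        MvPolynomial.C ((j : K) + 1) * MvPolynomial.X (Fin.castAdd 2 i))) =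
        MvPolynomial.aeval (p + ((j : K) + 1) • fun i => z (Fin.castAdd 2 i)) := by
      ext i
      simp
    have h1 := DFunLike.congr_fun this f
    simp only [AlgHom.comp_apply, MvPolynomial.aeval_eq_eval] at h1
    simp only [Q, map_sub, map_mul, map_pow, MvPolynomial.eval_C, MvPolynomial.eval_X]
    rw [← h1]
  obtain ⟨z, hz, hzQ⟩ := exists_ne_zero_forall_eval_eq_zero
    (Fin.cons (MvPolynomial.X (Fin.castAdd 2 i₀)) Q : Fin (n + 1) → _) (fun j => by
      refine Fin.cases ?_ (fun j => ?_) j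
      · simp
      · rw [Fin.cons_succ, hQ]
        have h1 : p + ((j : K) + 1) • (fun i => (0 : Fin (m + 2) → K) (Fin.castAdd 2 i)) = p := by
          ext i; simp
        rw [h1, hfp]
        simp [show n - 1 ≠ 0 by omega]) (by omega)
  have hz0 := hzQ 0
  simp only [Fin.cons_zero, MvPolynomial.eval_X] at hz0
  have hzj : ∀ j, MvPolynomial.eval z (Q j) = 0 := fun j => by simpa using hzQ j.succ
  set y : Fin m → K := fun i => z (Fin.castAdd 2 i) with hy
  set a := z (Fin.natAdd m 0)
  set b := z (Fin.natAdd m 1)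
  have key : restrictLine f p y =
      Polynomial.X * (Polynomial.C b - Polynomial.C a * Polynomial.X) ^ (n - 1) := by
    have hinj : Function.Injective fun j : Fin (n + 1) => (j : K) := by
      intro j j' h
      exact Fin.ext (Nat.cast_injective (R := K) h)
    refine Polynomial.eq_of_natDegree_lt_card_of_eval_eq _ _ hinj (fun j => ?_) ?_
    · refine Fin.cases ?_ (fun j => ?_) j
      · simp [eval_restrictLine, hfp]
      · have h1 := hzj j
        rw [hQ, sub_eq_zero] at h1
        rw [eval_restrictLine]
        simpa [y, a, b, mul_comm (z (Fin.natAdd m 0))] using h1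
    · rw [Fintype.card_fin, max_lt_iff]
      refine ⟨Nat.lt_succ_of_le (natDegree_restrictLine_le hf p y), Nat.lt_succ_of_le ?_⟩
      refine Polynomial.natDegree_mul_le.trans ?_
      have h1 : (Polynomial.C b - Polynomial.C a * Polynomial.X).natDegree ≤ 1 := by
        refine (Polynomial.natDegree_sub_le _ _).trans ?_
        simpa using (Polynomial.natDegree_C_mul_le a Polynomial.X).trans Polynomial.natDegree_X_le
      have h2 := Polynomial.natDegree_pow_le_of_le (n - 1) h1
      rw [Polynomial.natDegree_X]
      omega
  refine ⟨y, a, b, fun hy0 => hz ?_, hz0, key⟩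
  have h1 : ∀ t : K, t ≠ 0 → b - a * t = 0 := fun t ht => by
    have h2 := congrArg (Polynomial.eval t) key
    rw [eval_restrictLine, hy0, smul_zero, add_zero, hfp] at h2
    simp only [Polynomial.eval_mul, Polynomial.eval_X, Polynomial.eval_pow, Polynomial.eval_sub,
      Polynomial.eval_C] at h2
    exact eq_zero_of_pow_eq_zero ((mul_eq_zero.1 h2.symm).resolve_left ht)
  have h2 := h1 1 one_ne_zero
  have h3 := h1 2 two_ne_zero
  have ha : a = 0 := by linear_combination h2 - h3
  have hb : b = 0 := by linear_combination h2 + ha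
  ext i
  refine Fin.addCases (fun i => congrFun hy0 i) (fun i => ?_) i
  fin_cases i
  · exact ha
  · exact hb

theorem exists_line_of_eval_eq_zero [IsAlgClosed K] [CharZero K] (hf : f.IsHomogeneous n)
    (hn : 1 ≤ n) (hnm : n ≤ m) (hm : 2 ≤ m) (hp : p ≠ 0) (hfp : MvPolynomial.eval p f = 0) :
    ∃ (w : Fin m → K) (c : K), LinearIndependent K ![p, w] ∧
      ((c ≠ 0 ∧ ∀ t, MvPolynomial.eval (p + t • w) f = c * t) ∨
        ∀ t, MvPolynomial.eval (p + t • w) f = c * t ^ n) := by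
  obtain ⟨i₀, hi₀⟩ := Function.ne_iff.1 hp
  have hind : ∀ y : Fin m → K, y ≠ 0 → y i₀ = 0 → ∀ r : K,
      LinearIndependent K ![p, y + r • p] := by
    intro y hy hy0 r
    rw [LinearIndependent.pair_iff]
    intro s t hst
    have h1 : s + t * r = 0 := by
      have h2 := congrFun hst i₀
      simp only [Pi.add_apply, Pi.smul_apply, smul_eq_mul, hy0, Pi.zero_apply] at h2
      have h3 : (s + t * r) * p i₀ = 0 := by linear_combination h2
      exact (mul_eq_zero.1 h3).resolve_right hi₀
    have h2 : t • y = 0 := by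
      rw [← hst, smul_add, smul_smul, add_left_comm, ← add_smul, h1, zero_smul, add_zero]
    have ht : t = 0 := (smul_eq_zero.1 h2).resolve_right hy
    exact ⟨by simpa [ht] using h1, ht⟩
  rcases hn.eq_or_lt with rfl | hn
  · have : Nontrivial (Fin m) := Fin.nontrivial_iff_two_le.2 hm
    obtain ⟨j, hj⟩ := exists_ne i₀
    refine ⟨Pi.single j 1, (restrictLine f p (Pi.single j 1)).coeff 1, ?_, Or.inr fun t => ?_⟩
    · simpa using hind (Pi.single j 1) (by simp) (by simp [hj.symm]) 0
    · have h1 := Polynomial.eq_X_add_C_of_natDegree_le_one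
        (natDegree_restrictLine_le hf p (Pi.single j 1))
      have h2 : (restrictLine f p (Pi.single j 1)).coeff 0 = 0 := by
        rw [Polynomial.coeff_zero_eq_eval_zero, eval_restrictLine, zero_smul, add_zero, hfp]
      rw [← eval_restrictLine]
      conv_lhs => rw [h1, h2]
      simp
  · obtain ⟨y, a, b, hy, hy0, key⟩ := exists_restrictLine_eq_X_mul_pow hf hn hnm hfp i₀
    have heval : ∀ t, MvPolynomial.eval (p + t • y) f = t * (b - a * t) ^ (n - 1) := fun t => by
      rw [← eval_restrictLine, key]
      simp
    by_cases hb : b = 0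
    · refine ⟨y, (-a) ^ (n - 1), by simpa using hind y hy hy0 0, Or.inr fun t => ?_⟩
      obtain ⟨l, rfl⟩ : ∃ l, n = l + 1 := ⟨n - 1, by omega⟩
      rw [heval, hb]
      simp only [Nat.add_sub_cancel, zero_sub, ← neg_mul, mul_pow]
      ring
    · refine ⟨y + (a / b) • p, b ^ (n - 1), hind y hy hy0 _, Or.inl ⟨pow_ne_zero _ hb, ?_⟩⟩
      have h1 : (Polynomial.C (a / b) * Polynomial.X + 1) *
          (restrictLine f p (y + (a / b) • p) - Polynomial.C (b ^ (n - 1)) * Polynomial.X) = 0 := by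
        refine Polynomial.funext fun t => ?_
        rw [Polynomial.eval_mul, Polynomial.eval_sub, eval_restrictLine]
        simp only [Polynomial.eval_add, Polynomial.eval_mul, Polynomial.eval_C, Polynomial.eval_X,
          Polynomial.eval_one, Polynomial.eval_zero]
        by_cases hx : a / b * t + 1 = 0
        · rw [hx, zero_mul]
        obtain ⟨l, rfl⟩ : ∃ l, n = l + 1 := ⟨n - 1, by omega⟩
        have h2 : p + t • (y + (a / b) • p) =
            (a / b * t + 1) • (p + (t / (a / b * t + 1)) • y) := by
          rw [smul_add, smul_add, smul_smul, smul_smul, mul_div_cancel₀ _ hx, add_smul, one_smul,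
            mul_comm t]
          abel
        have h3 : (a / b * t + 1) * (b - a * (t / (a / b * t + 1))) = b := by
          rw [mul_sub, mul_left_comm, mul_div_cancel₀ _ hx]
          field_simp
          ring
        rw [h2, hf.eval_smul', heval]
        have h4 : (a / b * t + 1) ^ (l + 1) * (t / (a / b * t + 1) *
            (b - a * (t / (a / b * t + 1))) ^ (l + 1 - 1)) = b ^ l * t := by
          rw [Nat.add_sub_cancel, pow_succ]
          calc _ = (a / b * t + 1) * (t / (a / b * t + 1)) *
              ((a / b * t + 1) * (b - a * (t / (a / b * t + 1)))) ^ l := by rw [mul_pow]; ring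
            _ = _ := by rw [h3, mul_div_cancel₀ _ hx]; ring
        rw [h4, Nat.add_sub_cancel, sub_self, mul_zero]
      have h2 : (Polynomial.C (a / b) * Polynomial.X + 1 : Polynomial K) ≠ 0 := fun h => by
        simpa using congrArg (Polynomial.eval 0) h
      intro t
      have h3 := congrArg (Polynomial.eval t) (sub_eq_zero.1 ((mul_eq_zero.1 h1).resolve_left h2))
      rw [eval_restrictLine] at h3
      simpa using h3

end Lines

section Cone

open MvPolynomial

variable {K : Type v} [Field K] [IsAlgClosed K] [CharZero K] {m n : ℕ}
  {f : MvPolynomial (Fin m) K} {p w : Fin m → K}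

theorem exists_ker_eval_eq_span_of_linearSlice_eq_pow (hf : f.IsHomogeneous n) (hn : 2 ≤ n)
    (hpw : LinearIndependent K ![p, w]) {c : K} (hc : c ≠ 0)
    (h : linearSlice ![p, w] f = C c * X 1 ^ n) {i : Fin m} (hi : eval p (pderiv i f) ≠ 0) :
    ∃ (s : ℕ) (_ : 3 + s = m) (g : Fin (2 + s) → MvPolynomial (Fin m) K),
      RingHom.ker (eval p) = Ideal.span ({f} ∪ Set.range g) := by
  have hderiv : ∀ j : Fin 2, ∑ l, ![p, w] j l * eval p (pderiv l f) = 0 := by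
    intro j
    have h1 := congrArg (eval ![(1 : K), 0]) (pderiv_linearSlice ![p, w] j f)
    rw [h] at h1
    have h2 : ∀ q, eval ![(1 : K), 0] (linearSlice ![p, w] q) = eval p q := fun q => by
      simp [eval_linearSlice]
    simp only [map_sum, map_mul, eval_C, h2] at h1
    rw [← h1]
    have h3 : n - 1 ≠ 0 := by omega
    fin_cases j <;> simp [pderiv_X, h3]
  have hind : LinearIndependent K ![w, p, Pi.single i 1] := by
    rw [Fintype.linearIndependent_iff]
    intro e he
    simp only [Fin.sum_univ_three, Matrix.cons_val] at he
    have h2 : e 2 = 0 := by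
      have h3 : ∑ l, (e 0 • w + e 1 • p + e 2 • Pi.single i 1 : Fin m → K) l *
          eval p (pderiv l f) = 0 := by
        rw [he]
        simp
      simp only [Pi.add_apply, Pi.smul_apply, smul_eq_mul, add_mul, Finset.sum_add_distrib,
        mul_assoc, ← Finset.mul_sum] at h3
      have h4 := hderiv 0
      have h5 := hderiv 1
      simp only [Matrix.cons_val_zero, Matrix.cons_val_one] at h4 h5
      rw [h4, h5] at h3
      simpa [Pi.single_apply, hi] using h3
    have h3 := (LinearIndependent.pair_iff.1 hpw) (e 1) (e 0) (by
      rw [h2, zero_smul, add_zero] at he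
      rw [← he, add_comm])
    intro j
    fin_cases j
    · exact h3.2
    · exact h3.1
    · exact h2
  have hm : 3 ≤ m := by
    simpa using hind.fintype_card_le_finrank
  set F := linearSlice ![w, p, Pi.single i 1] f with hFdef
  have hF0 : (aeval ![X 0, X 1, 0] F : MvPolynomial (Fin 3) K) = C c * X 0 ^ n := by
    refine MvPolynomial.funext fun x => ?_
    have h1 : (aeval x).comp (aeval ![X 0, X 1, 0] : MvPolynomial (Fin 3) K →ₐ[K] _) =
        aeval ![x 0, x 1, 0] := by
      ext l
      fin_cases l <;> simp
    have h2 : eval x (aeval ![X 0, X 1, 0] F : MvPolynomial (Fin 3) K) = eval ![x 0, x 1, 0] F :=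
      DFunLike.congr_fun h1 F
    have h3 := congrArg (eval ![x 1, x 0]) h
    rw [eval_linearSlice] at h3
    rw [h2, hFdef, eval_linearSlice]
    simpa [Fin.sum_univ_three, add_comm] using h3
  obtain ⟨B, hB⟩ : ∃ B, B * X 2 = F - C c * X 0 ^ n := by
    rw [← Ideal.mem_span_singleton', ← hF0]
    refine sub_mem_span_of_aeval (φ := AlgHom.id K _) (fun l => ?_) F
    fin_cases l
    · simp
    · simp
    · simp
  have hF : F = C c * X 0 ^ n + X 2 * B := by linear_combination -hB
  have hBe : eval ![0, 1, 0] B ≠ 0 := by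
    have h1 := congrArg (eval ![(0 : K), 1, 0]) (pderiv_linearSlice ![w, p, Pi.single i 1] 2 f)
    have h2 : ∀ q, eval ![(0 : K), 1, 0] (linearSlice ![w, p, Pi.single i 1] q) = eval p q :=
      fun q => by simp [eval_linearSlice, Fin.sum_univ_three]
    simp only [map_sum, map_mul, eval_C, h2, Matrix.cons_val] at h1
    rw [← hFdef, hF] at h1
    simp [pderiv_X, Pi.single_apply] at h1
    rwa [h1]
  have hdeg : B.totalDegree < n := by
    have hB0 : B ≠ 0 := fun h0 => hBe (by rw [h0, map_zero])
    have h1 := totalDegree_mul_of_isDomain hB0 (X_ne_zero (R := K) (2 : Fin 3))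
    have h2 : (F - C c * X 0 ^ n).IsHomogeneous n :=
      (linearSlice_isHomogeneous _ hf).sub ((isHomogeneous_X_pow 0 n).C_mul c)
    rw [hB, totalDegree_X] at h1
    have := h2.totalDegree_le
    omega
  obtain ⟨g, hg⟩ := exists_ker_eval_eq_span_of_eq_add hc (by omega) hF hdeg hBe
  obtain ⟨s, hs⟩ := Nat.exists_eq_add_of_le hm
  obtain ⟨g', hg'⟩ := ker_eval_sum_eq_span_of_ker_eval_eq_span hs.symm hind ![0, 1, 0] g hg
  refine ⟨s, hs.symm, g', ?_⟩
  simpa [Fin.sum_univ_three] using hg'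

end Cone

/-- **Murthy / Srinivas complete intersection corollary.**
Let `k` be an algebraically closed field of characteristic zero, `d ≥ 1`, and
`f ∈ k[t₀,…,t_d]` a homogeneous polynomial of degree `n` with `1 ≤ n ≤ d + 1` whose partial
derivatives have no common zero in `k^{d+1}` other than the origin (so `f` defines a smooth
hypersurface in `ℙ^d_k`).  Then every maximal ideal `m` of `k[t₀,…,t_d]` containing `f`, other
than the irrelevant ideal `(t₀,…,t_d)`, is of the form `m = (f, f₁, …, f_d)`; i.e. every smooth
closed point of `Spec k[t₀,…,t_d]/(f)` is a complete intersection. -/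
theorem bloch_srinivas_complete_intersection
    (k : Type*) [Field k] [IsAlgClosed k] [CharZero k]
    (d n : ℕ) (hd : 1 ≤ d) (hn1 : 1 ≤ n) (hn2 : n ≤ d + 1)
    (f : MvPolynomial (Fin (d + 1)) k)
    (hf : f.IsHomogeneous n)
    (hsmooth : ∀ x : Fin (d + 1) → k,
      (∀ i : Fin (d + 1), MvPolynomial.eval x (MvPolynomial.pderiv i f) = 0) → x = 0)
    (m : Ideal (MvPolynomial (Fin (d + 1)) k)) (hm : m.IsMaximal)
    (hfm : f ∈ m)
    (hm0 : m ≠ Ideal.span (Set.range (MvPolynomial.X : Fin (d + 1) → MvPolynomial (Fin (d + 1)) k))) :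
    ∃ g : Fin d → MvPolynomial (Fin (d + 1)) k,
      m = Ideal.span ({f} ∪ Set.range g) := by
  obtain ⟨p, rfl⟩ : ∃ p : Fin (d + 1) → k, m = RingHom.ker (MvPolynomial.eval p) := by
    obtain ⟨p, rfl⟩ := MvPolynomial.isMaximal_iff_eq_vanishingIdeal_singleton.1 hm
    refine ⟨p, ?_⟩
    ext a
    simp [RingHom.mem_ker]
  have hp : p ≠ 0 := by
    rintro rfl
    exact hm0 (by rw [ker_eval_eq_span]; simp)
  have hcast : ∀ t, t = d → (∃ g : Fin t → MvPolynomial (Fin (d + 1)) k,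
      RingHom.ker (MvPolynomial.eval p) = Ideal.span ({f} ∪ Set.range g)) →
      ∃ g : Fin d → MvPolynomial (Fin (d + 1)) k,
        RingHom.ker (MvPolynomial.eval p) = Ideal.span ({f} ∪ Set.range g) := by
    rintro _ rfl h
    exact h
  obtain ⟨w, c, hpw, ⟨hc, h⟩ | h⟩ :=
    exists_line_of_eval_eq_zero hf hn1 hn2 (by omega) hp hfm
  · exact hcast (1 + (d - 1)) (by omega)
      (exists_ker_eval_eq_span_of_eval_line_eq_mul (by omega) hpw hc h)
  have hslice : linearSlice ![p, w] f = MvPolynomial.C c * MvPolynomial.X 1 ^ n :=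
    eq_C_mul_X_pow_of_eval (linearSlice_isHomogeneous _ hf) fun t => by
      rw [eval_linearSlice, ← h t]
      simp
  by_cases hc : c = 0
  · exact hcast (1 + (d - 1)) (by omega)
      (exists_ker_eval_eq_span_of_linearSlice_eq_zero (by omega) hpw (by simp [hslice, hc]) hsmooth)
  rcases hn1.eq_or_lt with rfl | hn
  · exact hcast (1 + (d - 1)) (by omega)
      (exists_ker_eval_eq_span_of_eval_line_eq_mul (by omega) hpw hc (by simpa using h))
  · obtain ⟨i, hi⟩ : ∃ i, MvPolynomial.eval p (MvPolynomial.pderiv i f) ≠ 0 := by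
      by_contra! h0
      exact hp (hsmooth p h0)
    obtain ⟨s, hs, hg⟩ := exists_ker_eval_eq_span_of_linearSlice_eq_pow hf hn hpw hc hslice hi
    exact hcast _ (by omega) hg
end

section
/- Let $R$ be a commutative ring and let $s, t \in R$ be non-zero-divisors. Then the lengths of $R$-modules satisfy $\mathrm{length}_R(R/stR) = \mathrm{length}_R(R/sR) + \mathrm{length}_R(R/tR)$ (as an equality in $\mathbb{N} \cup \{\infty\}$). This is the additivity underlying the fact that the order function $t \mapsto \mathrm{length}_{\mathcal{O}_{C,x}}(\mathcal{O}_{C,x}/t\mathcal{O}_{C,x})$ at a closed point $x$ of a curve is additive in $t$. -/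
/-- The length of an `R`-module `M`, valued in `ℕ ∪ {∞}` (here `WithBot ℕ∞`, though the
bottom element never occurs): the supremum of the lengths of chains of submodules of `M`,
i.e. the Krull dimension of the lattice of submodules. -/
noncomputable def moduleLength (R M : Type*) [Ring R] [AddCommGroup M] [Module R M] :
    WithBot ℕ∞ :=
  Order.krullDim (Submodule R M)

/-- The Krull dimension of the lattice of submodules agrees with `Module.length`. -/
theorem moduleLength_eq_coe_length (R M : Type*) [Ring R] [AddCommGroup M] [Module R M] :
    moduleLength R M = (Module.length R M : WithBot ℕ∞) :=
  (Module.coe_length R M).symm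

/-- Let `R` be a commutative ring and `s, t ∈ R` non-zero-divisors.  Then
`length_R (R/stR) = length_R (R/sR) + length_R (R/tR)`: the additivity underlying the fact
that the order function `t ↦ length (𝒪_{C,x} / t 𝒪_{C,x})` at a closed point of a curve is
additive in `t`. -/
theorem moduleLength_quotient_mul
    (R : Type*) [CommRing R] (s t : R)
    (hs : s ∈ nonZeroDivisors R) (ht : t ∈ nonZeroDivisors R) :
    moduleLength R (R ⧸ Ideal.span {s * t}) =
      moduleLength R (R ⧸ Ideal.span {s}) + moduleLength R (R ⧸ Ideal.span {t}) := by
  simp only [moduleLength_eq_coe_length]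
  rw [← WithBot.coe_add]
  exact congrArg _ (Ring.ord_mul R ht)
end

section
/- Let $R$ be a Noetherian local domain of Krull dimension at most $1$ with fraction field $K$. Then there exists a unique group homomorphism $\mathrm{ord} : K^{\times} \to \mathbb{Z}$ such that $\mathrm{ord}(t) = \mathrm{length}_R(R/tR)$ for every nonzero $t \in R$. -/
/-- Homomorphisms out of the units of a fraction field are determined by their values on the
units that come from the base ring. -/
theorem IsFractionRing.units_hom_ext {R K G : Type*} [CommRing R] [IsDomain R]
    [Field K] [Algebra R K] [IsFractionRing R K] [Group G] {f g : Kˣ →* G}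
    (h : ∀ t : R, t ≠ 0 → ∀ u : Kˣ, (u : K) = algebraMap R K t → f u = g u) : f = g := by
  ext u
  obtain ⟨a, b, hb, hab⟩ := IsFractionRing.div_surjective (A := R) (u : K)
  have hb0 : algebraMap R K b ≠ 0 := IsFractionRing.to_map_ne_zero_of_mem_nonZeroDivisors hb
  have ha0 : algebraMap R K a ≠ 0 := fun ha ↦ u.ne_zero (by rw [← hab, ha, zero_div])
  have hu : u = Units.mk0 _ ha0 / Units.mk0 _ hb0 := Units.ext (by simp [← hab])
  rw [hu, map_div, map_div, h a (by rintro rfl; simp at ha0) _ rfl,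
    h b (nonZeroDivisors.ne_zero hb) _ rfl]

/-- A nonzero element of a Noetherian domain of dimension at most `1` has the finite length of
its quotient as its order. -/
theorem Ring.exists_ordFrac_eq_length {R : Type*} [CommRing R] [IsDomain R] [IsNoetherianRing R]
    [Ring.KrullDimLE 1 R] (K : Type*) [Field K] [Algebra R K] [IsFractionRing R K]
    {t : R} (ht : t ≠ 0) :
    ∃ n : ℕ, Ring.ordFrac R (algebraMap R K t) = (Multiplicative.ofAdd (n : ℤ)) ∧
      moduleLength R (R ⧸ Ideal.span {t}) = (n : WithBot ℕ∞) := by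
  have ht' : t ∈ nonZeroDivisors R := mem_nonZeroDivisors_of_ne_zero ht
  obtain ⟨n, hn⟩ := ENat.ne_top_iff_exists.mp (Ring.ord_ne_top ht')
  refine ⟨n, ?_, ?_⟩
  · rw [Ring.ordFrac_eq_ord R ht, Ring.ordMonoidWithZeroHom_eq_coe R ht' hn.symm]
  · rw [moduleLength, ← Module.coe_length, ← Ring.ord, ← hn]
    rfl

/-- Let `R` be a Noetherian local domain of Krull dimension at most `1` with fraction field
`K`.  Then there is a unique group homomorphism `ord : Kˣ → ℤ` such that
`ord t = length_R (R/tR)` for every nonzero `t ∈ R` (these lengths being natural numbers). -/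
theorem exists_unique_order_function
    (R : Type*) [CommRing R] [IsDomain R] [IsNoetherianRing R] [IsLocalRing R]
    (hdim : ringKrullDim R ≤ 1)
    (K : Type*) [Field K] [Algebra R K] [IsFractionRing R K] :
    ∃! ord : Kˣ →* Multiplicative ℤ,
      ∀ t : R, t ≠ 0 → ∀ u : Kˣ, (u : K) = algebraMap R K t →
        ∃ n : ℕ, Multiplicative.toAdd (ord u) = (n : ℤ) ∧
          moduleLength R (R ⧸ Ideal.span {t}) = (n : WithBot ℕ∞) := by
  have : Ring.KrullDimLE 1 R := Ring.krullDimLE_iff.mpr (by exact_mod_cast hdim)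
  refine existsUnique_of_exists_of_unique ⟨WithZero.unitsWithZeroEquiv.toMonoidHom.comp
    (Units.map (Ring.ordFrac R : K →*₀ WithZero (Multiplicative ℤ)).toMonoidHom), ?_⟩ ?_
  · intro t ht u hu
    obtain ⟨n, hn, hlen⟩ := Ring.exists_ordFrac_eq_length K ht
    refine ⟨n, ?_, hlen⟩
    rw [← toAdd_ofAdd (n : ℤ)]
    congr 1
    apply WithZero.coe_injective
    rw [← hn, ← hu]
    exact WithZero.coe_unzero _
  · intro f g hf hg
    refine IsFractionRing.units_hom_ext (R := R) fun t ht u hu ↦ ?_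
    obtain ⟨m, hm, hm'⟩ := hf t ht u hu
    obtain ⟨n, hn, hn'⟩ := hg t ht u hu
    have hmn : m = n := by exact_mod_cast hm'.symm.trans hn'
    apply Multiplicative.toAdd.injective
    rw [hm, hn, hmn]
end
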